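/- arXiv:2501.10043 — 4 statements merged into one kernel-verified Lean document; each statement's English description precedes it below -/
import Mathlib

section
/- (Corollary 2.4, degree of the associated variety.) With F, n, n_1, n_2, Z', I as in the context, let p ∈ ℚ[k] be the polynomial with p(k) = dim_F(Z'_k/(I ∩ Z'_k)) for all sufficiently large k. Then (deg p)! times the leading coefficient of p equals: ((n−2)/(n_1−1) − (n−2)/(n_2−1))·C(n−3,n_1−2)·C(n−3,n_2−2) if 2 ≤ n_1 < n_2 < n; (1/(n_1−1))·C(n−4,n_1−2)·C(n−3,n_1−2) if 1 < n_1 = n_2 < n−1; and 1 if n_1 = n_2 = 1 < n or n_1 = n_2 = n−1. -/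
open MvPolynomial in
/-- The ideal `I` of `F[z_{i,j} : 1 ≤ i ≤ n-n₁, 1 ≤ j ≤ n₂]` generated by
(a) the variables `z_{i,j}` with `1 ≤ i ≤ n₂-n₁`, `n₁+1 ≤ j ≤ n₂`;
(b) the 2×2 minors with rows in `[1, n₂-n₁]` and columns in `[1, n₁]`;
(c) the 2×2 minors with rows in `[n₂-n₁+1, n-n₁]` and columns in `[n₁+1, n₂]`;
(d) all 3×3 minors.  (Indices of `Fin` are 0-based, so `i : Fin (n-n₁)` represents
the row `i+1`, and similarly for columns.) -/
noncomputable def detIdeal (F : Type*) [Field F] (n n₁ n₂ : ℕ) :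
    Ideal (MvPolynomial (Fin (n - n₁) × Fin n₂) F) :=
  Ideal.span
    ({ p | ∃ i : Fin (n - n₁), ∃ j : Fin n₂,
        (i : ℕ) < n₂ - n₁ ∧ n₁ ≤ (j : ℕ) ∧ p = X (i, j) } ∪
     { p | ∃ i i' : Fin (n - n₁), ∃ j j' : Fin n₂,
        i < i' ∧ (i' : ℕ) < n₂ - n₁ ∧ j < j' ∧ (j' : ℕ) < n₁ ∧
        p = X (i, j) * X (i', j') - X (i, j') * X (i', j) } ∪
     { p | ∃ i i' : Fin (n - n₁), ∃ j j' : Fin n₂,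
        n₂ - n₁ ≤ (i : ℕ) ∧ i < i' ∧ n₁ ≤ (j : ℕ) ∧ j < j' ∧
        p = X (i, j) * X (i', j') - X (i, j') * X (i', j) } ∪
     { p | ∃ i₁ i₂ i₃ : Fin (n - n₁), ∃ j₁ j₂ j₃ : Fin n₂,
        i₁ < i₂ ∧ i₂ < i₃ ∧ j₁ < j₂ ∧ j₂ < j₃ ∧
        p = X (i₁, j₁) * X (i₂, j₂) * X (i₃, j₃)
            + X (i₂, j₁) * X (i₃, j₂) * X (i₁, j₃)
            + X (i₃, j₁) * X (i₁, j₂) * X (i₂, j₃)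
            - X (i₂, j₁) * X (i₁, j₂) * X (i₃, j₃)
            - X (i₁, j₁) * X (i₃, j₂) * X (i₂, j₃)
            - X (i₃, j₁) * X (i₂, j₂) * X (i₁, j₃) })

/-- `hilbFn F n n₁ n₂ k` is `dim_F (Z'_k / (I ∩ Z'_k))`, the Hilbert function of the
homogeneous coordinate ring of the variety determined by `detIdeal F n n₁ n₂`. -/
noncomputable def hilbFn (F : Type*) [Field F] (n n₁ n₂ k : ℕ) : ℕ :=
  Module.finrank F
    ((MvPolynomial.homogeneousSubmodule (Fin (n - n₁) × Fin n₂) F k) ⧸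
      (Submodule.comap
        (MvPolynomial.homogeneousSubmodule (Fin (n - n₁) × Fin n₂) F k).subtype
        (Submodule.restrictScalars F (detIdeal F n n₁ n₂))))

section ImagePart

open MvPolynomial Module

variable {F : Type*} [Field F] {σ τ : Type*}

/-- The substitution setting the variable `w` to zero. -/
noncomputable def killVar (F : Type*) [Field F] [DecidableEq τ] (w : τ) :
    MvPolynomial τ F →ₐ[F] MvPolynomial τ F :=
  aeval fun v => if v = w then 0 else X v

/-- The degree-`k` part of the image of a homomorphism of polynomial rings. -/
noncomputable def imagePart (φ : MvPolynomial σ F →ₐ[F] MvPolynomial τ F) (k : ℕ) :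
    Submodule F (MvPolynomial τ F) :=
  (homogeneousSubmodule σ F k).map φ.toLinearMap

theorem finite_homogeneousSubmodule [Finite σ] (k : ℕ) :
    Module.Finite F (homogeneousSubmodule σ F k) :=
  Module.Finite.iff_fg.2 (homogeneousSubmodule_fg _ _ _)

instance finite_imagePart [Finite σ] (φ : MvPolynomial σ F →ₐ[F] MvPolynomial τ F) (k : ℕ) :
    Module.Finite F (imagePart φ k) :=
  have := finite_homogeneousSubmodule (F := F) (σ := σ) k
  Module.Finite.map _ _

theorem map_imagePart (φ : MvPolynomial σ F →ₐ[F] MvPolynomial τ F)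
    (ψ : MvPolynomial τ F →ₐ[F] MvPolynomial τ F) (k : ℕ) :
    (imagePart φ k).map ψ.toLinearMap = imagePart (ψ.comp φ) k := by
  rw [imagePart, imagePart, ← Submodule.map_comp]
  rfl

theorem mul_imagePart_le (φ : MvPolynomial σ F →ₐ[F] MvPolynomial τ F) (z : σ) (k : ℕ) :
    (imagePart φ k).map (LinearMap.mulLeft F (φ (X z))) ≤ imagePart φ (k + 1) := by
  rintro _ ⟨_, ⟨p, hp, rfl⟩, rfl⟩
  refine ⟨X z * p, ?_, by simp⟩
  have h : (X z * p).IsHomogeneous (1 + k) := (isHomogeneous_X F z).mul hp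
  rwa [add_comm] at h

theorem finrank_map_mulLeft {p : MvPolynomial τ F} (hp : p ≠ 0)
    (M : Submodule F (MvPolynomial τ F)) :
    finrank F (M.map (LinearMap.mulLeft F p)) = finrank F M :=
  (Submodule.equivMapOfInjective _ (mul_right_injective₀ hp) M).finrank_eq.symm

theorem Submodule.finrank_map_add_finrank_le {V V' : Type*} [AddCommGroup V] [Module F V]
    [AddCommGroup V'] [Module F V'] {M N : Submodule F V} [Module.Finite F M] (h : N ≤ M)
    (f : V →ₗ[F] V') (hf : N ≤ LinearMap.ker f) :
    finrank F (M.map f) + finrank F N ≤ finrank F M := by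
  have h1 := (f.domRestrict M).finrank_range_add_finrank_ker
  rw [LinearMap.range_domRestrict] at h1
  have h2 : finrank F N ≤ finrank F (LinearMap.ker (f.domRestrict M)) := by
    refine LinearMap.finrank_le_finrank_of_injective
      (f := (Submodule.inclusion h).codRestrict _ fun x => ?_) ?_
    · exact hf x.2
    · intro x y hxy
      exact Submodule.inclusion_injective h (congrArg Subtype.val hxy)
  omega

theorem killVar_X_self [DecidableEq τ] (w : τ) : killVar F w (X w) = 0 := by
  simp [killVar]

theorem killVar_X_of_ne [DecidableEq τ] {v w : τ} (h : v ≠ w) : killVar F w (X v) = X v := by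
  simp [killVar, h]

/-- If the variable `z` maps to `w₁ w₂`, the section of the image by `z = 0` dominates the image
with `w₁ = 0`. -/
theorem finrank_imagePart_add_le [Finite σ] [DecidableEq τ]
    (φ : MvPolynomial σ F →ₐ[F] MvPolynomial τ F) {z : σ} {w₁ w₂ : τ}
    (hz : φ (X z) = X w₁ * X w₂) (k : ℕ) :
    finrank F (imagePart φ k) + finrank F (imagePart ((killVar F w₁).comp φ) (k + 1)) ≤
      finrank F (imagePart φ (k + 1)) := by
  have hz0 : φ (X z) ≠ 0 := by simp [hz]
  have h := Submodule.finrank_map_add_finrank_le (mul_imagePart_le φ z k)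
    (killVar F w₁).toLinearMap (by
      rintro _ ⟨p, -, rfl⟩
      simp [hz, killVar_X_self])
  rw [map_imagePart, finrank_map_mulLeft hz0] at h
  omega

/-- If the variables `z` and `f` map to `w₁ w₂` and `w₁ w₃`, the section of the image by `z = 0`
contains the two components `w₁ = 0` and `w₂ = 0`, and `f` vanishes on the first only. -/
theorem finrank_imagePart_add_add_le [Finite σ] [DecidableEq τ]
    (φ : MvPolynomial σ F →ₐ[F] MvPolynomial τ F) {z f : σ} {w₁ w₂ w₃ : τ}
    (hz : φ (X z) = X w₁ * X w₂) (hf : φ (X f) = X w₁ * X w₃) (h₁ : w₁ ≠ w₂) (h₃ : w₃ ≠ w₂)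
    (k : ℕ) :
    finrank F (imagePart φ k) + finrank F (imagePart ((killVar F w₁).comp φ) (k + 1)) +
        finrank F (imagePart ((killVar F w₂).comp φ) k) ≤
      finrank F (imagePart φ (k + 1)) := by
  set N := (imagePart φ k).map (LinearMap.mulLeft F (φ (X z))) with hN
  set N' := (imagePart φ k).map (LinearMap.mulLeft F (φ (X f))) with hN'
  have hz0 : φ (X z) ≠ 0 := by simp [hz]
  have hfin : Module.Finite F (N ⊔ N' : Submodule F _) := Submodule.finite_sup _ _
  have hM := Submodule.finrank_map_add_finrank_le
    (sup_le (mul_imagePart_le φ z k) (mul_imagePart_le φ f k))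
    (killVar F w₁).toLinearMap (sup_le
      (by
        rintro _ ⟨p, -, rfl⟩
        simp [hz, killVar_X_self])
      (by
        rintro _ ⟨p, -, rfl⟩
        simp [hf, killVar_X_self]))
  have hK := Submodule.finrank_map_add_finrank_le (le_sup_left : N ≤ N ⊔ N')
    (killVar F w₂).toLinearMap (by
      rintro _ ⟨p, -, rfl⟩
      simp [hz, killVar_X_self])
  have hle : (imagePart ((killVar F w₂).comp φ) k).map
      (LinearMap.mulLeft F (X w₁ * X w₃ : MvPolynomial τ F)) ≤
      (N ⊔ N').map (killVar F w₂).toLinearMap := by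
    rw [← map_imagePart]
    rintro _ ⟨_, ⟨p, hp, rfl⟩, rfl⟩
    refine ⟨φ (X f) * p, Submodule.mem_sup_right ⟨p, hp, rfl⟩, ?_⟩
    simp [hf, killVar_X_of_ne h₁, killVar_X_of_ne h₃, mul_assoc]
  have hle' := Submodule.finrank_mono hle
  rw [finrank_map_mulLeft (by simp)] at hle'
  rw [map_imagePart, ← hN, ← hN'] at hM
  rw [hN, finrank_map_mulLeft hz0, ← hN] at hK
  omega

end ImagePart

section Growth

open Nat

/-- `f k ≤ D k ^ e / e! + O(k ^ (e - 1))`, expressed through multiset coefficients. -/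
def UpperGrowth (f : ℕ → ℕ) (e : ℕ) (D : ℤ) : Prop :=
  ∃ c : ℕ, ∀ k, (f k : ℤ) ≤ D * multichoose (e + 1) k + c * multichoose e k

/-- `D k ^ e / e! ≤ f k + O(k ^ (e - 1))`, expressed through multiset coefficients. -/
def LowerGrowth (f : ℕ → ℕ) (e : ℕ) (D : ℤ) : Prop :=
  ∃ c : ℕ, ∀ k, D * multichoose (e + 1) k ≤ (f k : ℤ) + c * multichoose e k

theorem Nat.multichoose_mono_left {m n : ℕ} (h : m ≤ n) (k : ℕ) :
    multichoose m k ≤ multichoose n k := by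
  induction n, h using Nat.le_induction with
  | base => rfl
  | succ n _ ih =>
    refine ih.trans ?_
    cases k with
    | zero => simp [multichoose_zero_right]
    | succ k => rw [multichoose_succ_succ]; omega

theorem UpperGrowth.mono {f g : ℕ → ℕ} {e : ℕ} {D : ℤ} (h : UpperGrowth g e D)
    (hfg : ∀ k, f k ≤ g k) : UpperGrowth f e D := by
  obtain ⟨c, hc⟩ := h
  exact ⟨c, fun k => le_trans (by exact_mod_cast hfg k) (hc k)⟩

theorem LowerGrowth.mono {f g : ℕ → ℕ} {e : ℕ} {D : ℤ} (h : LowerGrowth g e D)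
    (hgf : ∀ k, g k ≤ f k) : LowerGrowth f e D := by
  obtain ⟨c, hc⟩ := h
  exact ⟨c, fun k => (hc k).trans (by have := hgf k; gcongr)⟩

theorem LowerGrowth.zero (f : ℕ → ℕ) (e : ℕ) : LowerGrowth f e 0 :=
  ⟨0, fun k => by simp⟩

theorem UpperGrowth.zero_of_lt {f : ℕ → ℕ} {e : ℕ} {D : ℤ} (h : UpperGrowth f e D) :
    UpperGrowth f (e + 1) 0 := by
  obtain ⟨c, hc⟩ := h
  refine ⟨D.natAbs + c, fun k => (hc k).trans ?_⟩
  have h1 : (multichoose e k : ℤ) ≤ multichoose (e + 1) k := by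
    exact_mod_cast multichoose_mono_left (Nat.le_succ e) k
  have h2 : D ≤ |D| := le_abs_self D
  push_cast
  nlinarith [mul_le_mul_of_nonneg_right h2 (Nat.cast_nonneg (α := ℤ) (multichoose (e + 1) k)),
    mul_le_mul_of_nonneg_left h1 (Nat.cast_nonneg (α := ℤ) c)]

theorem UpperGrowth.step {f g g' : ℕ → ℕ} {e : ℕ} {D D' : ℤ}
    (hg : UpperGrowth g e D) (hg' : UpperGrowth g' e D')
    (hf : ∀ k, f (k + 1) ≤ f k + g (k + 1) + g' (k + 1)) : UpperGrowth f (e + 1) (D + D') := by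
  obtain ⟨c, hc⟩ := hg
  obtain ⟨c', hc'⟩ := hg'
  refine ⟨c + c' + f 0 + (D + D').natAbs, fun k => ?_⟩
  have habs : -|D + D'| ≤ D + D' := neg_abs_le _
  have hf0 : (0 : ℤ) ≤ f 0 := Nat.cast_nonneg _
  have habs0 : 0 ≤ |D + D'| := abs_nonneg _
  push_cast
  induction k with
  | zero =>
    simp only [multichoose_zero_right, Nat.cast_one, mul_one]
    have : (0 : ℤ) ≤ c := Nat.cast_nonneg _
    have : (0 : ℤ) ≤ c' := Nat.cast_nonneg _
    linarith
  | succ k ih =>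
    have h1 : (f (k + 1) : ℤ) ≤ f k + g (k + 1) + g' (k + 1) := by exact_mod_cast hf k
    have h2 := hc (k + 1)
    have h3 := hc' (k + 1)
    rw [multichoose_succ_succ (e + 1), multichoose_succ_succ e] at *
    have hm : (0 : ℤ) ≤ multichoose e (k + 1) := Nat.cast_nonneg _
    push_cast at *
    nlinarith [mul_nonneg hf0 hm, mul_nonneg habs0 hm]

theorem LowerGrowth.step {f g g' : ℕ → ℕ} {e : ℕ} {D D' : ℤ}
    (hg : LowerGrowth g (e + 1) D) (hg' : LowerGrowth g' (e + 1) D')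
    (hf : ∀ k, f k + g (k + 1) + g' k ≤ f (k + 1)) : LowerGrowth f (e + 2) (D + D') := by
  obtain ⟨c, hc⟩ := hg
  obtain ⟨c', hc'⟩ := hg'
  refine ⟨c + c' + D'.natAbs + (D + D').natAbs, fun k => ?_⟩
  have habs : D + D' ≤ |D + D'| := le_abs_self _
  have habs' : D' ≤ |D'| := le_abs_self _
  have habs0 : 0 ≤ |D + D'| := abs_nonneg _
  have habs0' : 0 ≤ |D'| := abs_nonneg _
  push_cast
  induction k with
  | zero =>
    simp only [multichoose_zero_right, Nat.cast_one, mul_one]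
    have : (0 : ℤ) ≤ c := Nat.cast_nonneg _
    have : (0 : ℤ) ≤ c' := Nat.cast_nonneg _
    have : (0 : ℤ) ≤ f 0 := Nat.cast_nonneg _
    linarith
  | succ k ih =>
    have h1 : (f k : ℤ) + g (k + 1) + g' k ≤ f (k + 1) := by exact_mod_cast hf k
    have h2 := hc (k + 1)
    have h3 := hc' k
    rw [multichoose_succ_succ (e + 2), multichoose_succ_succ (e + 1), multichoose_succ_succ e] at *
    have hm : (0 : ℤ) ≤ multichoose e (k + 1) := Nat.cast_nonneg _
    have hm' : (0 : ℤ) ≤ multichoose (e + 1) k := Nat.cast_nonneg _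
    have hc'0 : (0 : ℤ) ≤ c' := Nat.cast_nonneg _
    push_cast at *
    nlinarith [mul_nonneg habs0 hm, mul_nonneg habs0' hm, mul_nonneg habs0 hm',
      mul_nonneg habs0' hm', mul_nonneg hc'0 hm, mul_le_mul_of_nonneg_right habs' hm,
      mul_le_mul_of_nonneg_right habs' hm']

end Growth

section Asymptotics

open Nat Filter Asymptotics Topology

theorem Nat.mul_multichoose_succ (e k : ℕ) :
    e * multichoose (e + 1) k = (k + e) * multichoose e k := by
  cases e with
  | zero => cases k <;> simp [multichoose_zero_succ]
  | succ e =>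
    rw [multichoose_eq, multichoose_eq, show e + 1 + 1 + k - 1 = (e + k) + 1 by omega,
      show e + 1 + k - 1 = e + k by omega]
    have h1 := Nat.choose_symm_of_eq_add (show e + k + 1 = k + (e + 1) by omega)
    have h2 := Nat.choose_symm_of_eq_add (show e + k = k + e by omega)
    have h3 := Nat.add_one_mul_choose_eq (e + k) e
    rw [h1, h2]
    linarith

theorem isEquivalent_multichoose_succ (e : ℕ) :
    (fun k : ℕ => (multichoose (e + 1) k : ℝ)) ~[atTop]
      fun k : ℕ => (k ^ e / e.factorial : ℝ) := by
  have h := (isEquivalent_choose e).comp_tendsto (tendsto_add_atTop_nat e)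
  have h' : (fun k : ℕ => ((k + e : ℕ) : ℝ)) ~[atTop] fun k : ℕ => (k : ℝ) := by
    have hz : ∀ᶠ k : ℕ in atTop, ((k + e : ℕ) : ℝ) ≠ 0 :=
      eventually_atTop.mpr ⟨1, fun n hn => by positivity⟩
    refine ((isEquivalent_iff_tendsto_one hz).2 ?_).symm
    simpa using! tendsto_natCast_div_add_atTop (e : ℝ)
  refine IsEquivalent.trans (h.congr_left (.of_forall fun k => ?_))
    ((h'.pow e).div IsEquivalent.refl)
  simp only [Function.comp_apply, multichoose_eq]
  rw [Nat.choose_symm_of_eq_add (show k + e = e + k by omega)]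
  congr 2
  omega

theorem tendsto_div_multichoose_succ {f : ℕ → ℕ} {e : ℕ} {D : ℤ} (hU : UpperGrowth f e D)
    (hL : LowerGrowth f e D) :
    Tendsto (fun k => (f k : ℝ) / multichoose (e + 1) k) atTop (𝓝 D) := by
  obtain ⟨c, hc⟩ := hU
  obtain ⟨c', hc'⟩ := hL
  have hpos : ∀ k, (0 : ℝ) < multichoose (e + 1) k := fun k => by
    rw [multichoose_eq]
    exact_mod_cast Nat.choose_pos (by omega)
  have hlim : Tendsto (fun k : ℕ => (e : ℝ) / (k + e : ℕ)) atTop (𝓝 0) :=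
    (tendsto_const_div_atTop_nhds_zero_nat (e : ℝ)).comp (tendsto_add_atTop_nat e)
  have hratio : ∀ᶠ k : ℕ in atTop,
      (multichoose e k : ℝ) = (e : ℝ) / (k + e : ℕ) * multichoose (e + 1) k := by
    filter_upwards [eventually_ge_atTop 1] with k hk
    have h : (e : ℝ) * multichoose (e + 1) k = (k + e : ℕ) * multichoose e k := by
      exact_mod_cast mul_multichoose_succ e k
    have : ((k + e : ℕ) : ℝ) ≠ 0 := by positivity
    field_simp
    linarith
  refine tendsto_of_tendsto_of_tendsto_of_le_of_le'
    (g := fun k : ℕ => (D : ℝ) - c' * ((e : ℝ) / (k + e : ℕ)))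
    (h := fun k : ℕ => (D : ℝ) + c * ((e : ℝ) / (k + e : ℕ)))
    (by simpa using tendsto_const_nhds.sub (hlim.const_mul (c' : ℝ)))
    (by simpa using tendsto_const_nhds.add (hlim.const_mul (c : ℝ))) ?_ ?_
  · filter_upwards [hratio] with k hk
    rw [le_div_iff₀ (hpos k)]
    have : (D * multichoose (e + 1) k : ℝ) ≤ f k + c' * multichoose e k := by exact_mod_cast hc' k
    rw [hk] at this
    linarith
  · filter_upwards [hratio] with k hk
    rw [div_le_iff₀ (hpos k)]
    have : (f k : ℝ) ≤ D * multichoose (e + 1) k + c * multichoose e k := by exact_mod_cast hc k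
    rw [hk] at this
    linarith

theorem factorial_natDegree_mul_leadingCoeff {f : ℕ → ℕ} {e : ℕ} {D : ℤ} (hD : 0 < D)
    (hU : UpperGrowth f e D) (hL : LowerGrowth f e D) {p : Polynomial ℚ}
    (hp : ∀ᶠ k in atTop, (f k : ℚ) = p.eval (k : ℚ)) :
    (p.natDegree.factorial : ℚ) * p.leadingCoeff = D := by
  set P : Polynomial ℝ := p.map (algebraMap ℚ ℝ) with hP
  set Q : Polynomial ℝ := Polynomial.C (D / e.factorial : ℝ) * Polynomial.X ^ e with hQ
  have hD' : (0 : ℝ) < D := by exact_mod_cast hD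
  have hlead : (D / e.factorial : ℝ) ≠ 0 := by positivity
  have hPk : ∀ᶠ k : ℕ in atTop, (f k : ℝ) = P.eval (k : ℝ) := by
    filter_upwards [hp] with k hk
    have h := Polynomial.eval_map_apply (algebraMap ℚ ℝ) (p := p) (k : ℚ)
    rw [← hk, ← hP, map_natCast, map_natCast] at h
    exact h.symm
  have hPQ : Tendsto (fun k : ℕ => P.eval (k : ℝ) / Q.eval (k : ℝ)) atTop (𝓝 1) := by
    have h1 := (tendsto_div_multichoose_succ hU hL).div_const (D : ℝ)
    rw [div_self hD'.ne'] at h1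
    have hz : ∀ᶠ k : ℕ in atTop, (k ^ e / e.factorial : ℝ) ≠ 0 :=
      eventually_atTop.mpr ⟨1, fun n hn => by positivity⟩
    have h2 := (isEquivalent_iff_tendsto_one hz).1 (isEquivalent_multichoose_succ e)
    have h3 := h1.mul h2
    rw [mul_one] at h3
    refine h3.congr' ?_
    filter_upwards [hPk, eventually_ge_atTop 1] with k hk hk1
    have hpos : (multichoose (e + 1) k : ℝ) ≠ 0 := by
      rw [multichoose_eq]
      exact_mod_cast (Nat.choose_pos (by omega)).ne'
    rw [← hk]
    simp only [hQ, Polynomial.eval_mul, Polynomial.eval_C, Polynomial.eval_pow, Polynomial.eval_X,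
      Pi.div_apply]
    have : (k : ℝ) ≠ 0 := by positivity
    field_simp
  have hcast : Tendsto (fun k : ℕ => (k : ℝ)) atTop atTop := tendsto_natCast_atTop_atTop
  have hQdeg : Q.natDegree = e := Polynomial.natDegree_C_mul_X_pow e _ hlead
  have hQlead : Q.leadingCoeff = D / e.factorial := Polynomial.leadingCoeff_C_mul_X_pow _ _
  have hdeg : P.degree = Q.degree := by
    rcases lt_trichotomy P.degree Q.degree with h | h | h
    · exact absurd (tendsto_nhds_unique hPQ
        ((Polynomial.div_tendsto_atTop_zero_of_degree_lt P Q h).comp hcast)) one_ne_zero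
    · exact h
    · have h1 := hPQ.inv₀ one_ne_zero
      simp only [inv_div, inv_one] at h1
      exact absurd (tendsto_nhds_unique h1
        ((Polynomial.div_tendsto_atTop_zero_of_degree_lt Q P h).comp hcast)) one_ne_zero
  have hcoeff := tendsto_nhds_unique hPQ
    ((Polynomial.div_tendsto_atTop_leadingCoeff_div_of_degree_eq P Q hdeg).comp hcast)
  have hPdeg : p.natDegree = e := by
    rw [← hQdeg, ← Polynomial.natDegree_eq_of_degree_eq hdeg, hP, Polynomial.natDegree_map]
  have hPlead : P.leadingCoeff = (p.leadingCoeff : ℝ) := by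
    rw [hP, Polynomial.leadingCoeff_map]
    rfl
  rw [hQlead, hPlead, eq_div_iff hlead, one_mul, div_eq_iff (by positivity)] at hcoeff
  rw [hPdeg, mul_comm]
  exact_mod_cast hcoeff.symm

end Asymptotics

section DegreeCoeff

open Nat

/-- `n.choose (k - 1)`, with the value `0` at `k = 0`. -/
def Nat.choosePred (n : ℕ) : ℕ → ℕ
  | 0 => 0
  | k + 1 => n.choose k

theorem Nat.choosePred_succ_left (n k : ℕ) :
    choosePred (n + 1) (k + 1) = choosePred n k + choosePred n (k + 1) := by
  cases k with
  | zero => simp [choosePred]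
  | succ k => simp [choosePred, Nat.choose_succ_succ]

/-- The coefficient of `k ^ e / e!`, `e = a + c + 2 β + 2 ρ`, in the Hilbert function of the
matrices `[A 0; B C]` with `rank A ≤ 1`, `rank C ≤ 1` and total rank at most `2`, where `A` has
`a` rows, `B` has `ρ + 1` rows and `β + 1` columns, and `C` has `c` columns. -/
def degreeCoeff (a β ρ c : ℕ) : ℤ :=
  (a + ρ + β - 1).choose β * (ρ + β + c - 1).choose ρ -
    choosePred (a + ρ + β - 1) β * choosePred (ρ + β + c - 1) ρ

theorem degreeCoeff_comm (a β ρ c : ℕ) : degreeCoeff a β ρ c = degreeCoeff c ρ β a := by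
  rw [degreeCoeff, degreeCoeff, show ρ + β + c - 1 = c + β + ρ - 1 by omega,
    show a + ρ + β - 1 = β + ρ + a - 1 by omega]
  ring

theorem degreeCoeff_left (a β ρ c : ℕ) :
    degreeCoeff (a + 1) (β + 1) ρ c =
      degreeCoeff a (β + 1) ρ c + degreeCoeff (a + 1) β ρ (c + 1) := by
  simp only [degreeCoeff]
  rw [show a + 1 + ρ + (β + 1) - 1 = a + ρ + β + 1 by omega,
    show a + ρ + (β + 1) - 1 = a + ρ + β by omega,
    show a + 1 + ρ + β - 1 = a + ρ + β by omega,
    show ρ + (β + 1) + c - 1 = ρ + β + c by omega,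
    show ρ + β + (c + 1) - 1 = ρ + β + c by omega,
    Nat.choose_succ_succ, choosePred_succ_left]
  push_cast
  ring

theorem degreeCoeff_right (a β ρ c : ℕ) :
    degreeCoeff a β (ρ + 1) (c + 1) =
      degreeCoeff a β (ρ + 1) c + degreeCoeff (a + 1) β ρ (c + 1) := by
  rw [degreeCoeff_comm, degreeCoeff_left, degreeCoeff_comm c, degreeCoeff_comm (c + 1)]

theorem degreeCoeff_zero_zero (a c : ℕ) : degreeCoeff a 0 0 c = 1 := by
  simp [degreeCoeff, choosePred]

theorem degreeCoeff_row (β c : ℕ) : degreeCoeff 0 (β + 1) 0 c = 0 := by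
  simp [degreeCoeff, choosePred]

theorem degreeCoeff_column (a ρ : ℕ) : degreeCoeff a 0 (ρ + 1) 0 = 0 := by
  rw [degreeCoeff_comm, degreeCoeff_row]

theorem degreeCoeff_generic (β ρ : ℕ) : degreeCoeff 0 (β + 1) (ρ + 1) 0 = 0 := by
  simp only [degreeCoeff, choosePred]
  rw [show 0 + (ρ + 1) + (β + 1) - 1 = ρ + β + 1 by omega,
    show ρ + 1 + (β + 1) + 0 - 1 = ρ + β + 1 by omega,
    Nat.choose_symm_of_eq_add (show ρ + β + 1 = β + 1 + ρ by omega),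
    Nat.choose_symm_of_eq_add (show ρ + β + 1 = ρ + 1 + β by omega)]
  ring

theorem degreeCoeff_eq_zero {a β ρ c : ℕ} (h : a = 0 ∨ β = 0) (h' : c = 0 ∨ ρ = 0)
    (h0 : ¬(β = 0 ∧ ρ = 0)) : degreeCoeff a β ρ c = 0 := by
  rcases β with _ | β <;> rcases ρ with _ | ρ
  · simp at h0
  · obtain rfl : c = 0 := by omega
    exact degreeCoeff_column a ρ
  · obtain rfl : a = 0 := by omega
    exact degreeCoeff_row β c
  · obtain rfl : a = 0 := by omega
    obtain rfl : c = 0 := by omega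
    exact degreeCoeff_generic β ρ

end DegreeCoeff

section FactorMap

open MvPolynomial Module

variable (F : Type*) [Field F] {ι κ : Type*} [DecidableEq ι] [DecidableEq κ]

/-- The generic matrix `p q + p' q'` of rank two, where the column vectors `p`, `p'` are supported
on `P`, `P'` and the row vectors `q`, `q'` are supported on `Q`, `Q'`. -/
noncomputable def factorMap (P P' : Finset ι) (Q Q' : Finset κ) :
    MvPolynomial (ι × κ) F →ₐ[F] MvPolynomial ((ι ⊕ ι) ⊕ (κ ⊕ κ)) F :=
  aeval fun x =>
    (if x.1 ∈ P then X (.inl (.inl x.1)) else 0) * (if x.2 ∈ Q then X (.inr (.inl x.2)) else 0) +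
    (if x.1 ∈ P' then X (.inl (.inr x.1)) else 0) * (if x.2 ∈ Q' then X (.inr (.inr x.2)) else 0)

variable {P P' : Finset ι} {Q Q' : Finset κ}

theorem factorMap_X (i : ι) (j : κ) :
    factorMap F P P' Q Q' (X (i, j)) =
      (if i ∈ P then X (.inl (.inl i)) else 0) * (if j ∈ Q then X (.inr (.inl j)) else 0) +
      (if i ∈ P' then X (.inl (.inr i)) else 0) * (if j ∈ Q' then X (.inr (.inr j)) else 0) := by
  simp [factorMap]

theorem killVar_comp_factorMap_left (i : ι) :
    (killVar F (.inl (.inl i))).comp (factorMap F P P' Q Q') =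
      factorMap F (P.erase i) P' Q Q' := by
  refine algHom_ext fun ⟨i', j'⟩ => ?_
  rw [AlgHom.comp_apply, factorMap_X, factorMap_X]
  simp only [map_add, map_mul, apply_ite (killVar F _), map_zero, Finset.mem_erase]
  split_ifs <;> simp_all [killVar]

theorem killVar_comp_factorMap_left' (i : ι) :
    (killVar F (.inl (.inr i))).comp (factorMap F P P' Q Q') =
      factorMap F P (P'.erase i) Q Q' := by
  refine algHom_ext fun ⟨i', j'⟩ => ?_
  rw [AlgHom.comp_apply, factorMap_X, factorMap_X]
  simp only [map_add, map_mul, apply_ite (killVar F _), map_zero, Finset.mem_erase]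
  split_ifs <;> simp_all [killVar]

theorem killVar_comp_factorMap_right (j : κ) :
    (killVar F (.inr (.inl j))).comp (factorMap F P P' Q Q') =
      factorMap F P P' (Q.erase j) Q' := by
  refine algHom_ext fun ⟨i', j'⟩ => ?_
  rw [AlgHom.comp_apply, factorMap_X, factorMap_X]
  simp only [map_add, map_mul, apply_ite (killVar F _), map_zero, Finset.mem_erase]
  split_ifs <;> simp_all [killVar]

theorem killVar_comp_factorMap_right' (j : κ) :
    (killVar F (.inr (.inr j))).comp (factorMap F P P' Q Q') =
      factorMap F P P' Q (Q'.erase j) := by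
  refine algHom_ext fun ⟨i', j'⟩ => ?_
  rw [AlgHom.comp_apply, factorMap_X, factorMap_X]
  simp only [map_add, map_mul, apply_ite (killVar F _), map_zero, Finset.mem_erase]
  split_ifs <;> simp_all [killVar]

theorem factorMap_X_top {i : ι} {j : κ} (hi : i ∈ P \ P') (hj : j ∈ Q) :
    factorMap F P P' Q Q' (X (i, j)) = X (.inl (.inl i)) * X (.inr (.inl j)) := by
  rw [Finset.mem_sdiff] at hi
  simp [factorMap_X, hi.1, hi.2, hj]

theorem factorMap_X_right {i : ι} {j : κ} (hi : i ∈ P') (hj : j ∈ Q' \ Q) :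
    factorMap F P P' Q Q' (X (i, j)) = X (.inl (.inr i)) * X (.inr (.inr j)) := by
  rw [Finset.mem_sdiff] at hj
  simp [factorMap_X, hi, hj.1, hj.2]

theorem finrank_imagePart_pos [Finite ι] [Finite κ] {i : ι} {j : κ} (hi : i ∈ P') (hi' : i ∈ P)
    (hj : j ∈ Q) (hj' : j ∈ Q') (k : ℕ) :
    0 < finrank F (imagePart (factorMap F P P' Q Q') k) := by
  have h0 : factorMap F P P' Q Q' (X (i, j)) ≠ 0 := by
    intro h
    have h1 := congrArg (eval (Sum.elim (Sum.elim 1 0) (Sum.elim 1 0))) h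
    simp [factorMap_X, hi, hi', hj, hj'] at h1
  rw [Module.finrank_pos_iff_exists_ne_zero]
  refine ⟨⟨factorMap F P P' Q Q' (X (i, j) ^ k), X (i, j) ^ k, ?_, rfl⟩, ?_⟩
  · simpa using (isHomogeneous_X F (i, j)).pow k
  · rw [ne_eq, Subtype.ext_iff]
    simpa using pow_ne_zero k h0

/-- The Hilbert function of a hook of independent variables. -/
theorem multichoose_le_finrank_imagePart [Finite ι] [Finite κ] {i : ι} {j : κ} (hi : i ∈ P')
    (hi' : i ∈ P) (hj : j ∈ Q) (hj' : j ∈ Q') (n : ℕ) (hn : (P \ P').card + (Q' \ Q).card = n)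
    (k : ℕ) :
    (n + 1).multichoose k ≤ finrank F (imagePart (factorMap F P P' Q Q') k) := by
  induction n generalizing P Q' k with
  | zero =>
    rw [Nat.multichoose_one]
    exact finrank_imagePart_pos F hi hi' hj hj' k
  | succ n ih =>
    induction k with
    | zero =>
      rw [Nat.multichoose_zero_right]
      exact finrank_imagePart_pos F hi hi' hj hj' 0
    | succ k ihk =>
      rw [Nat.multichoose_succ_succ]
      rcases Nat.eq_zero_or_pos (P \ P').card with h | h
      · obtain ⟨j₁, hj₁⟩ : (Q' \ Q).Nonempty := Finset.card_pos.1 (by omega)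
        have hne : j ≠ j₁ := by
          rintro rfl
          exact (Finset.mem_sdiff.1 hj₁).2 hj
        have h1 := finrank_imagePart_add_le (factorMap F P P' Q Q') (z := (i, j₁))
          ((factorMap_X_right F hi hj₁).trans (mul_comm _ _)) k
        rw [killVar_comp_factorMap_right'] at h1
        have h2 := ih (Q' := Q'.erase j₁) hi' (Finset.mem_erase.2 ⟨hne, hj'⟩) (by
          rw [Finset.erase_sdiff_comm, Finset.card_erase_of_mem hj₁]; omega) (k + 1)
        omega
      · obtain ⟨i₁, hi₁⟩ := Finset.card_pos.1 h
        have hne : i ≠ i₁ := by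
          rintro rfl
          exact (Finset.mem_sdiff.1 hi₁).2 hi
        have h1 := finrank_imagePart_add_le (factorMap F P P' Q Q') (z := (i₁, j))
          (factorMap_X_top F hi₁ hj) k
        rw [killVar_comp_factorMap_left] at h1
        have h2 := ih (P := P.erase i₁) (Finset.mem_erase.2 ⟨hne, hi'⟩) hj' (by
          rw [Finset.erase_sdiff_comm, Finset.card_erase_of_mem hi₁]; omega) (k + 1)
        omega

theorem card_sdiff_erase {α : Type*} [DecidableEq α] {s t : Finset α} {x : α} {n : ℕ} (hx : x ∈ s)
    (hst : s ⊆ t) (hn : (t \ s).card = n) : (t \ s.erase x).card = n + 1 := by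
  rw [Finset.sdiff_erase (hst hx), Finset.card_insert_of_notMem (by simp [hx]), hn]

theorem lowerGrowth_factorMap_of_hook [Finite ι] [Finite κ] (hP : P' ⊆ P) (hQ : Q ⊆ Q') {a c : ℕ}
    (ha : (P \ P').card = a) (hβ : Q.card = 0 + 1) (hρ : P'.card = 0 + 1)
    (hc : (Q' \ Q).card = c) :
    LowerGrowth (fun k => finrank F (imagePart (factorMap F P P' Q Q') k))
      (a + c + 2 * 0 + 2 * 0) (degreeCoeff a 0 0 c) := by
  obtain ⟨j, hj⟩ : Q.Nonempty := Finset.card_pos.1 (by omega)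
  obtain ⟨i, hi⟩ : P'.Nonempty := Finset.card_pos.1 (by omega)
  refine ⟨0, fun k => ?_⟩
  rw [degreeCoeff_zero_zero]
  simpa using multichoose_le_finrank_imagePart F hi (hP hi) hj (hQ hj) (a + c) (by omega) k

theorem lowerGrowth_factorMap [Finite ι] [Finite κ] (hP : P' ⊆ P) (hQ : Q ⊆ Q') {a β ρ c : ℕ}
    (ha : (P \ P').card = a) (hβ : Q.card = β + 1) (hρ : P'.card = ρ + 1)
    (hc : (Q' \ Q).card = c) :
    LowerGrowth (fun k => finrank F (imagePart (factorMap F P P' Q Q') k))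
      (a + c + 2 * β + 2 * ρ) (degreeCoeff a β ρ c) := by
  obtain ⟨N, hN⟩ : ∃ N, a + c + 2 * β + 2 * ρ = N := ⟨_, rfl⟩
  induction N generalizing P P' Q Q' a β ρ c with
  | zero =>
    obtain ⟨rfl, rfl, rfl, rfl⟩ : a = 0 ∧ c = 0 ∧ β = 0 ∧ ρ = 0 := by omega
    exact lowerGrowth_factorMap_of_hook F hP hQ ha hβ hρ hc
  | succ N ih =>
    by_cases hleft : 0 < a ∧ 0 < β
    · obtain ⟨a, rfl⟩ := Nat.exists_eq_succ_of_ne_zero hleft.1.ne'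
      obtain ⟨β, rfl⟩ := Nat.exists_eq_succ_of_ne_zero hleft.2.ne'
      obtain ⟨i, hi⟩ : (P \ P').Nonempty := Finset.card_pos.1 (by omega)
      obtain ⟨j, hj, j', hj', hjj'⟩ := Finset.one_lt_card.1 (show 1 < Q.card by omega)
      have h1 := ih (P := P.erase i) (Finset.subset_erase.2 ⟨hP, (Finset.mem_sdiff.1 hi).2⟩) hQ
        (by rw [Finset.erase_sdiff_comm, Finset.card_erase_of_mem hi]; omega) hβ hρ hc
        (a := a) (by omega)
      have h2 := ih (Q := Q.erase j) hP ((Finset.erase_subset _ _).trans hQ) ha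
        ((Finset.card_erase_of_mem hj).trans (Nat.sub_eq_of_eq_add hβ)) hρ
        (card_sdiff_erase hj hQ hc) (by omega)
      rw [degreeCoeff_left, show a + 1 + c + 2 * (β + 1) + 2 * ρ =
        a + c + 2 * β + 1 + 2 * ρ + 2 by omega]
      rw [show a + c + 2 * (β + 1) + 2 * ρ = a + c + 2 * β + 1 + 2 * ρ + 1 by omega] at h1
      rw [show a + 1 + (c + 1) + 2 * β + 2 * ρ = a + c + 2 * β + 1 + 2 * ρ + 1 by omega] at h2
      refine h1.step h2 fun k => ?_
      have h3 := finrank_imagePart_add_add_le (factorMap F P P' Q Q') (z := (i, j)) (f := (i, j'))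
        (factorMap_X_top F hi hj) (factorMap_X_top F hi hj') (by simp) (by simpa using hjj'.symm) k
      rwa [killVar_comp_factorMap_left, killVar_comp_factorMap_right] at h3
    by_cases hright : 0 < c ∧ 0 < ρ
    · obtain ⟨c, rfl⟩ := Nat.exists_eq_succ_of_ne_zero hright.1.ne'
      obtain ⟨ρ, rfl⟩ := Nat.exists_eq_succ_of_ne_zero hright.2.ne'
      obtain ⟨j, hj⟩ : (Q' \ Q).Nonempty := Finset.card_pos.1 (by omega)
      obtain ⟨i, hi, i', hi', hii'⟩ := Finset.one_lt_card.1 (show 1 < P'.card by omega)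
      have h1 := ih (Q' := Q'.erase j) hP (Finset.subset_erase.2 ⟨hQ, (Finset.mem_sdiff.1 hj).2⟩)
        ha hβ hρ (by rw [Finset.erase_sdiff_comm, Finset.card_erase_of_mem hj]; omega)
        (c := c) (by omega)
      have h2 := ih (P' := P'.erase i) ((Finset.erase_subset _ _).trans hP) hQ
        (card_sdiff_erase hi hP ha) hβ
        ((Finset.card_erase_of_mem hi).trans (Nat.sub_eq_of_eq_add hρ)) hc (by omega)
      rw [degreeCoeff_right, show a + (c + 1) + 2 * β + 2 * (ρ + 1) =
        a + c + 2 * β + 1 + 2 * ρ + 2 by omega]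
      rw [show a + c + 2 * β + 2 * (ρ + 1) = a + c + 2 * β + 1 + 2 * ρ + 1 by omega] at h1
      rw [show a + 1 + (c + 1) + 2 * β + 2 * ρ = a + c + 2 * β + 1 + 2 * ρ + 1 by omega] at h2
      refine h1.step h2 fun k => ?_
      have h3 := finrank_imagePart_add_add_le (factorMap F P P' Q Q') (z := (i, j)) (f := (i', j))
        ((factorMap_X_right F hi hj).trans (mul_comm _ _))
        ((factorMap_X_right F hi' hj).trans (mul_comm _ _)) (by simp) (by simpa using hii'.symm) k
      rwa [killVar_comp_factorMap_right', killVar_comp_factorMap_left'] at h3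
    by_cases hhook : β = 0 ∧ ρ = 0
    · obtain ⟨rfl, rfl⟩ := hhook
      exact lowerGrowth_factorMap_of_hook F hP hQ ha hβ hρ hc
    · rw [degreeCoeff_eq_zero (by omega) (by omega) (by omega)]
      exact LowerGrowth.zero _ _

end FactorMap

section Standard

variable {ι κ : Type*} [LinearOrder ι] [LinearOrder κ]

/-- A monomial in the entries of a matrix, written as a multiset of positions, is standard if it
avoids the entries which vanish on the matrices `p q + p' q'` of `factorMap` and the leading terms
of the minors which vanish there. -/
structure IsStandard (P P' : Finset ι) (Q Q' : Finset κ) (m : Multiset (ι × κ)) : Prop where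
  cell : ∀ x ∈ m, x.1 ∈ P ∧ x.2 ∈ Q' ∧ (x.1 ∈ P' ∨ x.2 ∈ Q)
  top : ∀ x ∈ m, ∀ y ∈ m, x.1 < y.1 → x.2 < y.2 → y.1 ∈ P'
  right : ∀ x ∈ m, ∀ y ∈ m, x.1 < y.1 → x.2 < y.2 → x.2 ∈ Q
  chain : ∀ x ∈ m, ∀ y ∈ m, ∀ z ∈ m, x.1 < y.1 → x.2 < y.2 → y.1 < z.1 → ¬y.2 < z.2

/-- The number of standard monomials of degree `k`. -/
noncomputable def standardCount (P P' : Finset ι) (Q Q' : Finset κ) (k : ℕ) : ℕ :=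
  {m : Sym (ι × κ) k | IsStandard P P' Q Q' (m : Multiset (ι × κ))}.ncard

variable {P P' : Finset ι} {Q Q' : Finset κ} {m m' : Multiset (ι × κ)}

theorem IsStandard.mono (h : IsStandard P P' Q Q' m') (hm : m ⊆ m') :
    IsStandard P P' Q Q' m where
  cell x hx := h.cell x (hm hx)
  top x hx y hy := h.top x (hm hx) y (hm hy)
  right x hx y hy := h.right x (hm hx) y (hm hy)
  chain x hx y hy z hz := h.chain x (hm hx) y (hm hy) z (hm hz)

theorem IsStandard.erase_top {i : ι} (h : IsStandard P P' Q Q' m)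
    (hm : ∀ x ∈ m, x.1 ≠ i) : IsStandard (P.erase i) P' Q Q' m :=
  { h with
    cell := fun x hx => ⟨Finset.mem_erase.2 ⟨hm x hx, (h.cell x hx).1⟩, (h.cell x hx).2⟩ }

theorem IsStandard.erase_right {j : κ} (h : IsStandard P P' Q Q' m)
    (hm : ∀ x ∈ m, x.2 ≠ j) : IsStandard P P' Q (Q'.erase j) m :=
  { h with
    cell := fun x hx => ⟨(h.cell x hx).1, Finset.mem_erase.2 ⟨hm x hx, (h.cell x hx).2.1⟩,
      (h.cell x hx).2.2⟩ }

theorem IsStandard.erase_left {i : ι} {j : κ} (h : IsStandard P P' Q Q' m) (hi : i ∉ P')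
    (hP : ∀ i' ∈ P, i ≤ i') (hQ : ∀ j' ∈ Q, j' ≤ j) (hij : (i, j) ∉ m)
    (hm : ∃ x ∈ m, x.1 = i) : IsStandard P P' (Q.erase j) Q' m := by
  obtain ⟨⟨i₀, j₀⟩, h₀, hi₀⟩ := hm
  obtain rfl : i = i₀ := hi₀.symm
  have hlt : j₀ < j := by
    refine lt_of_le_of_ne (hQ _ ((h.cell _ h₀).2.2.resolve_left hi)) ?_
    rintro rfl
    exact hij h₀
  have hrow : ∀ x ∈ m, x.2 = j → (i, j₀).1 < x.1 := by
    rintro ⟨i', _⟩ hx rfl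
    refine lt_of_le_of_ne (hP _ (h.cell _ hx).1) ?_
    rintro rfl
    exact hij hx
  constructor
  · intro x hx
    obtain ⟨h1, h2, h3⟩ := h.cell x hx
    refine ⟨h1, h2, or_iff_not_imp_left.2 fun hx' => ?_⟩
    refine Finset.mem_erase.2 ⟨fun hxj => hx' ?_, h3.resolve_left hx'⟩
    exact h.top _ h₀ x hx (hrow x hx hxj) (hxj ▸ hlt)
  · exact h.top
  · intro x hx y hy h1 h2
    refine Finset.mem_erase.2 ⟨fun hxj => ?_, h.right x hx y hy h1 h2⟩
    exact h.chain _ h₀ x hx y hy (hrow x hx hxj) (hxj ▸ hlt) h1 h2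
  · exact h.chain

theorem IsStandard.erase_bottom {i : ι} {j : κ} (h : IsStandard P P' Q Q' m) (hj : j ∉ Q)
    (hP : ∀ i' ∈ P', i ≤ i') (hQ : ∀ j' ∈ Q', j' ≤ j) (hij : (i, j) ∉ m)
    (hm : ∃ x ∈ m, x.2 = j) : IsStandard P (P'.erase i) Q Q' m := by
  obtain ⟨⟨i₀, j₀⟩, h₀, hj₀⟩ := hm
  obtain rfl : j = j₀ := hj₀.symm
  have hlt : i < i₀ := by
    refine lt_of_le_of_ne (hP _ ((h.cell _ h₀).2.2.resolve_right hj)) ?_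
    rintro rfl
    exact hij h₀
  have hcol : ∀ x ∈ m, x.1 = i → x.2 < (i₀, j).2 := by
    rintro ⟨_, j'⟩ hx rfl
    refine lt_of_le_of_ne (hQ _ (h.cell _ hx).2.1) ?_
    rintro rfl
    exact hij hx
  constructor
  · intro x hx
    obtain ⟨h1, h2, h3⟩ := h.cell x hx
    refine ⟨h1, h2, or_iff_not_imp_right.2 fun hx' => ?_⟩
    refine Finset.mem_erase.2 ⟨fun hxi => hx' ?_, h3.resolve_right hx'⟩
    exact h.right x hx _ h₀ (hxi ▸ hlt) (hcol x hx hxi)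
  · intro x hx y hy h1 h2
    refine Finset.mem_erase.2 ⟨fun hyi => ?_, h.top x hx y hy h1 h2⟩
    exact h.chain x hx y hy _ h₀ h1 h2 (hyi ▸ hlt) (hcol y hy hyi)
  · exact h.right
  · exact h.chain

theorem IsStandard.erase_min {i : ι} (h : IsStandard P P Q Q m) (hP : ∀ i' ∈ P, i ≤ i') :
    IsStandard P (P.erase i) Q Q m where
  cell x hx := ⟨(h.cell x hx).1, (h.cell x hx).2.1, .inr (h.cell x hx).2.1⟩
  top x hx y hy h1 _ := Finset.mem_erase.2
    ⟨((hP _ (h.cell x hx).1).trans_lt h1).ne', (h.cell y hy).1⟩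
  right x hx _ _ _ _ := (h.cell x hx).2.1
  chain := h.chain

theorem ncard_sym_le_multichoose {α : Type*} {k : ℕ} {s : Finset α} {t : Set (Sym α k)}
    (h : ∀ m ∈ t, ∀ x ∈ m, x ∈ s) : t.ncard ≤ s.card.multichoose k := by
  classical
  have hcard : (Set.univ : Set (Sym s k)).ncard = s.card.multichoose k := by
    rw [Set.ncard_univ, Nat.card_eq_fintype_card, Sym.card_sym_eq_multichoose, Fintype.card_coe]
  rw [← hcard]
  refine (Set.ncard_le_ncard (t := Sym.map (Subtype.val : s → α) '' Set.univ) fun m hm => ?_).trans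
    Set.ncard_image_le
  refine ⟨m.attach.map fun x => ⟨x.1, h m hm x.1 x.2⟩, trivial, ?_⟩
  rw [Sym.map_map]
  exact Sym.attach_map_coe m

theorem standardCount_le_multichoose {a β ρ c : ℕ} (hP : P' ⊆ P)
    (ha : (P \ P').card = a) (hβ : Q.card = β + 1) (hρ : P'.card = ρ + 1)
    (hc : (Q' \ Q).card = c) (k : ℕ) :
    standardCount P P' Q Q' k ≤
      ((a + ρ + 1) * (β + 1) + (ρ + 1) * c).multichoose k := by
  have hPcard : P.card = a + ρ + 1 := by
    rw [← Finset.card_sdiff_add_card_eq_card hP, ha, hρ, add_assoc]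
  rw [← hPcard, ← hβ, ← hρ, ← hc, ← Finset.card_product, ← Finset.card_product]
  refine le_trans ?_ (Nat.multichoose_mono_left (Finset.card_union_le _ _) k)
  refine ncard_sym_le_multichoose fun m hm x hx => ?_
  have h := IsStandard.cell hm x hx
  simp only [Finset.mem_union, Finset.mem_product, Finset.mem_sdiff]
  tauto

variable [Finite ι] [Finite κ]

theorem standardCount_le_of_imp {R R' : Finset ι} {S S' : Finset κ}
    (h : ∀ m, IsStandard P P' Q Q' m → IsStandard R R' S S' m) (k : ℕ) :
    standardCount P P' Q Q' k ≤ standardCount R R' S S' k := by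
  have := Fintype.ofFinite ι
  have := Fintype.ofFinite κ
  exact Set.ncard_le_ncard (fun m hm => h _ hm)

theorem standardCount_succ_le {R₁ R₁' R₂ R₂' : Finset ι} {S₁ S₁' S₂ S₂' : Finset κ} (w : ι × κ)
    (h : ∀ m, IsStandard P P' Q Q' m → w ∉ m →
      IsStandard R₁ R₁' S₁ S₁' m ∨ IsStandard R₂ R₂' S₂ S₂' m) (k : ℕ) :
    standardCount P P' Q Q' (k + 1) ≤ standardCount P P' Q Q' k +
      standardCount R₁ R₁' S₁ S₁' (k + 1) + standardCount R₂ R₂' S₂ S₂' (k + 1) := by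
  have := Fintype.ofFinite ι
  have := Fintype.ofFinite κ
  have hsub : {m : Sym (ι × κ) (k + 1) | IsStandard P P' Q Q' (m : Multiset (ι × κ))} ⊆
      (Sym.cons w '' {m : Sym (ι × κ) k | IsStandard P P' Q Q' (m : Multiset (ι × κ))}) ∪
      {m : Sym (ι × κ) (k + 1) | IsStandard R₁ R₁' S₁ S₁' (m : Multiset (ι × κ))} ∪
      {m : Sym (ι × κ) (k + 1) | IsStandard R₂ R₂' S₂ S₂' (m : Multiset (ι × κ))} := by
    intro m hm
    by_cases hw : w ∈ m
    · obtain ⟨m', rfl⟩ := Sym.exists_cons_of_mem hw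
      exact .inl (.inl ⟨m', IsStandard.mono hm (Multiset.subset_cons _ _), rfl⟩)
    · rcases h _ hm hw with h' | h'
      · exact .inl (.inr h')
      · exact .inr h'
  refine (Set.ncard_le_ncard hsub).trans ((Set.ncard_union_le _ _).trans ?_)
  refine Nat.add_le_add_right ((Set.ncard_union_le _ _).trans ?_) _
  exact Nat.add_le_add_right (Set.ncard_image_le) _

theorem upperGrowth_standardCount (hP : P' ⊆ P) (hQ : Q ⊆ Q')
    (hP' : ∀ i ∈ P \ P', ∀ i' ∈ P', i < i') (hQ' : ∀ j ∈ Q, ∀ j' ∈ Q' \ Q, j < j')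
    {a β ρ c : ℕ} (ha : (P \ P').card = a) (hβ : Q.card = β + 1) (hρ : P'.card = ρ + 1)
    (hc : (Q' \ Q).card = c) :
    UpperGrowth (standardCount P P' Q Q') (a + c + 2 * β + 2 * ρ) (degreeCoeff a β ρ c) := by
  obtain ⟨N, hN⟩ : ∃ N, a + c + 2 * β + 2 * ρ = N := ⟨_, rfl⟩
  induction N generalizing P P' Q Q' a β ρ c with
  | zero =>
    obtain ⟨rfl, rfl, rfl, rfl⟩ : a = 0 ∧ c = 0 ∧ β = 0 ∧ ρ = 0 := by omega
    refine ⟨0, fun k => ?_⟩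
    rw [degreeCoeff_zero_zero]
    simpa using standardCount_le_multichoose hP ha hβ hρ hc k
  | succ N ih =>
    have hcount := standardCount_le_multichoose hP ha hβ hρ hc
    by_cases hleft : 0 < a ∧ 0 < β
    · obtain ⟨a, rfl⟩ := Nat.exists_eq_succ_of_ne_zero hleft.1.ne'
      obtain ⟨β, rfl⟩ := Nat.exists_eq_succ_of_ne_zero hleft.2.ne'
      obtain ⟨i, hi, hmin⟩ := (P \ P').exists_min_image id (Finset.card_pos.1 (by omega))
      obtain ⟨j, hj, hmax⟩ := Q.exists_max_image id (Finset.card_pos.1 (by omega))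
      have hi' := (Finset.mem_sdiff.1 hi).2
      have h1 := ih (P := P.erase i) (Finset.subset_erase.2 ⟨hP, hi'⟩) hQ
        (fun i₁ hi₁ => hP' i₁ (Finset.sdiff_subset_sdiff (Finset.erase_subset _ _) le_rfl hi₁)) hQ'
        (by rw [Finset.erase_sdiff_comm, Finset.card_erase_of_mem hi]; omega) hβ hρ hc
        (a := a) (by omega)
      have h2 := ih (Q := Q.erase j) hP ((Finset.erase_subset _ _).trans hQ) hP'
        (fun j₁ hj₁ j₂ hj₂ => by
          rw [Finset.mem_erase] at hj₁
          rw [Finset.sdiff_erase (hQ hj), Finset.mem_insert] at hj₂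
          rcases hj₂ with rfl | hj₂
          · exact lt_of_le_of_ne (hmax j₁ hj₁.2) hj₁.1
          · exact hQ' j₁ hj₁.2 j₂ hj₂) ha
        ((Finset.card_erase_of_mem hj).trans (Nat.sub_eq_of_eq_add hβ)) hρ
        (card_sdiff_erase hj hQ hc) (by omega)
      rw [degreeCoeff_left, show a + 1 + c + 2 * (β + 1) + 2 * ρ =
        a + c + 2 * (β + 1) + 2 * ρ + 1 by omega]
      rw [show a + 1 + (c + 1) + 2 * β + 2 * ρ = a + c + 2 * (β + 1) + 2 * ρ by omega] at h2
      refine h1.step h2 (standardCount_succ_le (i, j) fun m hm hw => ?_)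
      by_cases hrow : ∃ x ∈ m, x.1 = i
      · refine .inr (hm.erase_left hi' (fun i' hi'' => ?_) hmax hw hrow)
        by_cases h : i' ∈ P'
        · exact (hP' i hi i' h).le
        · exact hmin i' (Finset.mem_sdiff.2 ⟨hi'', h⟩)
      · push Not at hrow
        exact .inl (hm.erase_top hrow)
    by_cases hright : 0 < c ∧ 0 < ρ
    · obtain ⟨c, rfl⟩ := Nat.exists_eq_succ_of_ne_zero hright.1.ne'
      obtain ⟨ρ, rfl⟩ := Nat.exists_eq_succ_of_ne_zero hright.2.ne'
      obtain ⟨j, hj, hmax⟩ := (Q' \ Q).exists_max_image id (Finset.card_pos.1 (by omega))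
      obtain ⟨i, hi, hmin⟩ := P'.exists_min_image id (Finset.card_pos.1 (by omega))
      have hj' := (Finset.mem_sdiff.1 hj).2
      have h1 := ih (Q' := Q'.erase j) hP (Finset.subset_erase.2 ⟨hQ, hj'⟩) hP'
        (fun j₁ hj₁ j₂ hj₂ => hQ' j₁ hj₁ j₂
          (Finset.sdiff_subset_sdiff (Finset.erase_subset _ _) le_rfl hj₂))
        ha hβ hρ (by rw [Finset.erase_sdiff_comm, Finset.card_erase_of_mem hj]; omega)
        (c := c) (by omega)
      have h2 := ih (P' := P'.erase i) ((Finset.erase_subset _ _).trans hP) hQ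
        (fun i₁ hi₁ i₂ hi₂ => by
          rw [Finset.mem_erase] at hi₂
          rw [Finset.sdiff_erase (hP hi), Finset.mem_insert] at hi₁
          rcases hi₁ with rfl | hi₁
          · exact lt_of_le_of_ne (hmin i₂ hi₂.2) hi₂.1.symm
          · exact hP' i₁ hi₁ i₂ hi₂.2) hQ'
        (card_sdiff_erase hi hP ha) hβ
        ((Finset.card_erase_of_mem hi).trans (Nat.sub_eq_of_eq_add hρ)) hc (by omega)
      rw [degreeCoeff_right, show a + (c + 1) + 2 * β + 2 * (ρ + 1) =
        a + c + 2 * β + 2 * (ρ + 1) + 1 by omega]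
      rw [show a + 1 + (c + 1) + 2 * β + 2 * ρ = a + c + 2 * β + 2 * (ρ + 1) by omega] at h2
      refine h1.step h2 (standardCount_succ_le (i, j) fun m hm hw => ?_)
      by_cases hcol : ∃ x ∈ m, x.2 = j
      · refine .inr (hm.erase_bottom hj' hmin (fun j' hj'' => ?_) hw hcol)
        by_cases h : j' ∈ Q
        · exact (hQ' j' h j hj).le
        · exact hmax j' (Finset.mem_sdiff.2 ⟨hj'', h⟩)
      · push Not at hcol
        exact .inl (hm.erase_right hcol)
    by_cases hhook : β = 0 ∧ ρ = 0
    · obtain ⟨rfl, rfl⟩ := hhook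
      refine ⟨0, fun k => ?_⟩
      rw [degreeCoeff_zero_zero]
      have h := hcount k
      rw [show (a + 0 + 1) * (0 + 1) + (0 + 1) * c = a + c + 1 by ring] at h
      simpa using h
    rw [degreeCoeff_eq_zero (by omega) (by omega) hhook]
    have hsmall : (a + ρ + 1) * (β + 1) + (ρ + 1) * c ≤ a + c + 2 * β + 2 * ρ →
        UpperGrowth (standardCount P P' Q Q') (a + c + 2 * β + 2 * ρ) 0 := fun h =>
      ⟨1, fun k => by simpa using (hcount k).trans (Nat.multichoose_mono_left h k)⟩
    by_cases hβ0 : β = 0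
    · obtain rfl : c = 0 := by omega
      subst hβ0
      exact hsmall (by omega)
    obtain rfl : a = 0 := by omega
    by_cases hρ0 : ρ = 0
    · subst hρ0
      exact hsmall (by omega)
    obtain rfl : c = 0 := by omega
    obtain ⟨ρ, rfl⟩ := Nat.exists_eq_succ_of_ne_zero hρ0
    obtain rfl : P = P' := Finset.Subset.antisymm (by simpa using ha) hP
    obtain rfl : Q = Q' := Finset.Subset.antisymm hQ (by simpa using hc)
    obtain ⟨i, hi, hmin⟩ := P.exists_min_image id (Finset.card_pos.1 (by omega))
    have h := ih (P' := P.erase i) (Finset.erase_subset _ _) hQ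
      (fun i₁ hi₁ i₂ hi₂ => by
        rw [Finset.mem_erase] at hi₂
        rw [Finset.sdiff_erase hi, sdiff_self, Finset.bot_eq_empty, insert_empty_eq,
          Finset.mem_singleton] at hi₁
        rw [hi₁]
        exact lt_of_le_of_ne (hmin i₂ hi₂.2) hi₂.1.symm) hQ'
      (card_sdiff_erase hi hP ha) hβ
      ((Finset.card_erase_of_mem hi).trans (Nat.sub_eq_of_eq_add hρ)) hc (by omega)
    rw [show 0 + 0 + 2 * β + 2 * (ρ + 1) = 0 + 1 + 0 + 2 * β + 2 * ρ + 1 by omega]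
    exact h.zero_of_lt.mono (standardCount_le_of_imp fun m hm => hm.erase_min hmin)

end Standard

section HilbertFunction

open MvPolynomial Module

variable (F : Type*) [Field F] {n n₁ n₂ : ℕ}

theorem detIdeal_le_ker_factorMap {P P' : Finset (Fin (n - n₁))} {Q Q' : Finset (Fin n₂)}
    (hP' : ∀ i ∈ P', n₂ - n₁ ≤ (i : ℕ)) (hQ : ∀ j ∈ Q, (j : ℕ) < n₁) :
    detIdeal F n n₁ n₂ ≤ RingHom.ker (factorMap F P P' Q Q') := by
  have hP'' : ∀ i : Fin (n - n₁), (i : ℕ) < n₂ - n₁ → i ∉ P' := fun i hi h =>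
    absurd (hP' i h) (by omega)
  have hQ'' : ∀ j : Fin n₂, n₁ ≤ (j : ℕ) → j ∉ Q := fun j hj h => absurd (hQ j h) (by omega)
  refine Ideal.span_le.2 ?_
  rintro p (((⟨i, j, hi, hj, rfl⟩ | ⟨i, i', j, j', hi, hi', hj, hj', rfl⟩) |
    ⟨i, i', j, j', hi, hi', hj, hj', rfl⟩) | ⟨i₁, i₂, i₃, j₁, j₂, j₃, -, -, -, -, rfl⟩)
  · simp [factorMap_X, hP'' i hi, hQ'' j hj]
  · rw [SetLike.mem_coe, RingHom.mem_ker]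
    simp only [map_sub, map_mul, factorMap_X, hP'' i (by omega), hP'' i' hi', if_false]
    ring
  · rw [SetLike.mem_coe, RingHom.mem_ker]
    simp only [map_sub, map_mul, factorMap_X, hQ'' j hj, hQ'' j' (by omega), if_false]
    ring
  · rw [SetLike.mem_coe, RingHom.mem_ker]
    simp only [map_sub, map_mul, map_add, factorMap_X]
    ring

theorem finrank_imagePart_le_hilbFn {P P' : Finset (Fin (n - n₁))} {Q Q' : Finset (Fin n₂)}
    (hP' : ∀ i ∈ P', n₂ - n₁ ≤ (i : ℕ)) (hQ : ∀ j ∈ Q, (j : ℕ) < n₁) (k : ℕ) :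
    finrank F (imagePart (factorMap F P P' Q Q') k) ≤ hilbFn F n n₁ n₂ k := by
  have := finite_homogeneousSubmodule (F := F) (σ := Fin (n - n₁) × Fin n₂) k
  rw [hilbFn]
  set H := homogeneousSubmodule (Fin (n - n₁) × Fin n₂) F k
  set K := Submodule.comap H.subtype (Submodule.restrictScalars F (detIdeal F n n₁ n₂))
  have hK : K ≤ LinearMap.ker ((factorMap F P P' Q Q').toLinearMap ∘ₗ H.subtype) := fun x hx =>
    detIdeal_le_ker_factorMap F hP' hQ hx
  have h := (K.liftQ _ hK).finrank_range_le
  rwa [Submodule.range_liftQ, LinearMap.range_comp, Submodule.range_subtype] at h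

theorem Nat.swap_lt {i i' j j' : ℕ} (hi : i < i') (hj : j < j') :
    i * j' + i' * j < i * j + i' * j' := by
  obtain ⟨a, rfl⟩ := Nat.exists_eq_add_of_lt hi
  obtain ⟨b, rfl⟩ := Nat.exists_eq_add_of_lt hj
  nlinarith [Nat.zero_le (a * b)]

/-- The span of the standard monomials of degree `k`, modulo `detIdeal`. -/
noncomputable def standardSpan (n n₁ n₂ k : ℕ) :
    Submodule F (MvPolynomial (Fin (n - n₁) × Fin n₂) F) :=
  Submodule.span F ((fun m : Sym (Fin (n - n₁) × Fin n₂) k => (Multiset.map X m.1).prod) ''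
    {m | IsStandard Finset.univ {i : Fin (n - n₁) | n₂ - n₁ ≤ (i : ℕ)}
      {j : Fin n₂ | (j : ℕ) < n₁} Finset.univ (m : Multiset (Fin (n - n₁) × Fin n₂))})

theorem prod_map_X_mem_standardSpan_sup (m : Multiset (Fin (n - n₁) × Fin n₂)) :
    (m.map X).prod ∈ standardSpan F n n₁ n₂ m.card ⊔
      Submodule.restrictScalars F (detIdeal F n n₁ n₂) := by
  induction hw : (m.map fun x => (x.1 : ℕ) * (x.2 : ℕ)).sum using Nat.strong_induction_on
    generalizing m with
  | _ w ih =>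
  subst hw
  set I := detIdeal F n n₁ n₂ with hI
  have ih' : ∀ (s t : Multiset (Fin (n - n₁) × Fin n₂)), s.card + t.card = m.card →
      ((s + t).map fun x => (x.1 : ℕ) * (x.2 : ℕ)).sum <
        (m.map fun x => (x.1 : ℕ) * (x.2 : ℕ)).sum →
      (s.map X).prod * (t.map X).prod ∈ standardSpan F n n₁ n₂ m.card ⊔
        Submodule.restrictScalars F I := fun s t hc hlt => by
    have := ih _ hlt (s + t) rfl
    rwa [Multiset.card_add, hc, Multiset.map_add, Multiset.prod_add] at this
  have hmul : ∀ p ∈ I, ∀ q, p * q ∈ standardSpan F n n₁ n₂ m.card ⊔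
      Submodule.restrictScalars F I := fun p hp q =>
    Submodule.mem_sup_right (I.mul_mem_right q hp)
  have hswap : ∀ x y t, m = x ::ₘ y ::ₘ t → x.1 < y.1 → x.2 < y.2 →
      X x * X y - X (x.1, y.2) * X (y.1, x.2) ∈ I → (m.map X).prod ∈
        standardSpan F n n₁ n₂ m.card ⊔ Submodule.restrictScalars F I := by
    intro x y t hm h1 h2 hgen
    have h3 := ih' {(x.1, y.2), (y.1, x.2)} t (by simp [hm]; omega) (by
      have := Nat.swap_lt h1 h2
      simp [hm]
      omega)
    have h4 := add_mem h3 (hmul _ hgen (t.map X).prod)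
    convert h4 using 1
    simp [hm]
    ring
  by_cases hcell : ∃ x ∈ m, (x.1 : ℕ) < n₂ - n₁ ∧ n₁ ≤ (x.2 : ℕ)
  · obtain ⟨x, hx, h1, h2⟩ := hcell
    obtain ⟨t, ht⟩ := Multiset.exists_cons_of_mem hx
    have h := hmul (X x) (Ideal.subset_span (.inl (.inl (.inl ⟨x.1, x.2, h1, h2, rfl⟩))))
      (t.map X).prod
    convert h using 1
    simp [ht]
  push Not at hcell
  have hpair : ∀ x ∈ m, ∀ y ∈ m, x.1 < y.1 → ∃ t, m = x ::ₘ y ::ₘ t := by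
    intro x hx y hy h1
    obtain ⟨t, ht⟩ := Multiset.exists_cons_of_mem hx
    rw [ht, Multiset.mem_cons] at hy
    rcases hy with rfl | hy
    · exact absurd h1 (lt_irrefl _)
    · obtain ⟨t', ht'⟩ := Multiset.exists_cons_of_mem hy
      exact ⟨t', ht.trans (by rw [ht'])⟩
  by_cases htop : ∃ x ∈ m, ∃ y ∈ m, x.1 < y.1 ∧ x.2 < y.2 ∧ (y.1 : ℕ) < n₂ - n₁
  · obtain ⟨x, hx, y, hy, h1, h2, h3⟩ := htop
    obtain ⟨t, ht⟩ := hpair x hx y hy h1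
    exact hswap x y t ht h1 h2 (Ideal.subset_span (.inl (.inl (.inr
      ⟨x.1, y.1, x.2, y.2, h1, h3, h2, hcell y hy h3, rfl⟩))))
  push Not at htop
  by_cases hright : ∃ x ∈ m, ∃ y ∈ m, x.1 < y.1 ∧ x.2 < y.2 ∧ n₁ ≤ (x.2 : ℕ)
  · obtain ⟨x, hx, y, hy, h1, h2, h3⟩ := hright
    obtain ⟨t, ht⟩ := hpair x hx y hy h1
    refine hswap x y t ht h1 h2 (Ideal.subset_span (.inl (.inr
      ⟨x.1, y.1, x.2, y.2, ?_, h1, h3, h2, rfl⟩)))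
    by_contra h
    exact absurd (hcell x hx (by omega)) (by omega)
  push Not at hright
  by_cases hchain : ∃ x ∈ m, ∃ y ∈ m, ∃ z ∈ m, x.1 < y.1 ∧ x.2 < y.2 ∧ y.1 < z.1 ∧ y.2 < z.2
  · obtain ⟨⟨i₁, j₁⟩, hx, ⟨i₂, j₂⟩, hy, ⟨i₃, j₃⟩, hz, h1, h2, h3, h4⟩ := hchain
    dsimp only at h1 h2 h3 h4
    obtain ⟨t, ht⟩ : ∃ t, m = (i₁, j₁) ::ₘ (i₂, j₂) ::ₘ (i₃, j₃) ::ₘ t := by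
      obtain ⟨t, ht⟩ := hpair _ hx _ hy h1
      rw [ht, Multiset.mem_cons, Multiset.mem_cons, Prod.mk.injEq, Prod.mk.injEq] at hz
      rcases hz with ⟨rfl, -⟩ | ⟨rfl, -⟩ | hz
      · exact absurd (h1.trans h3) (lt_irrefl _)
      · exact absurd h3 (lt_irrefl _)
      · obtain ⟨t', ht'⟩ := Multiset.exists_cons_of_mem hz
        exact ⟨t', ht.trans (by rw [ht'])⟩
    have hcard : t.card + 3 = m.card := by simp [ht]
    have s1 := Nat.swap_lt h1 h2
    have s2 := Nat.swap_lt h1 h4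
    have s3 := Nat.swap_lt h1 (h2.trans h4)
    have s4 := Nat.swap_lt h3 h2
    have s5 := Nat.swap_lt h3 h4
    have s6 := Nat.swap_lt h3 (h2.trans h4)
    have s7 := Nat.swap_lt (h1.trans h3) h2
    have s8 := Nat.swap_lt (h1.trans h3) h4
    have s9 := Nat.swap_lt (h1.trans h3) (h2.trans h4)
    have hperm : ∀ x y z : Fin (n - n₁) × Fin n₂, (x.1 : ℕ) * x.2 + y.1 * y.2 + z.1 * z.2 <
        (i₁ : ℕ) * j₁ + i₂ * j₂ + i₃ * j₃ →
        X x * X y * X z * (t.map X).prod ∈ standardSpan F n n₁ n₂ m.card ⊔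
          Submodule.restrictScalars F I := by
      intro x y z hlt
      have h := ih' {x, y, z} t (by simp [← hcard]; omega) (by
        simp [ht]
        omega)
      convert h using 1
      simp
      ring
    have hgen := hmul _ (Ideal.subset_span (.inr ⟨i₁, i₂, i₃, j₁, j₂, j₃, h1, h3, h2, h4, rfl⟩))
      (t.map X).prod
    have h := sub_mem (add_mem (add_mem (add_mem hgen
      (hperm (i₂, j₁) (i₁, j₂) (i₃, j₃) (by dsimp only; omega)))
      (hperm (i₁, j₁) (i₃, j₂) (i₂, j₃) (by dsimp only; omega)))
      (hperm (i₃, j₁) (i₂, j₂) (i₁, j₃) (by dsimp only; omega)))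
      (add_mem (hperm (i₂, j₁) (i₃, j₂) (i₁, j₃) (by dsimp only; omega))
      (hperm (i₃, j₁) (i₁, j₂) (i₂, j₃) (by dsimp only; omega)))
    convert h using 1
    simp only [ht, Multiset.map_cons, Multiset.prod_cons]
    ring
  push Not at hchain
  refine Submodule.mem_sup_left (Submodule.subset_span ⟨⟨m, rfl⟩, ?_, rfl⟩)
  constructor
  · intro x hx
    have := hcell x hx
    simp only [Finset.mem_univ, Finset.mem_filter, true_and]
    omega
  · intro x hx y hy h1 h2
    simpa using htop x hx y hy h1 h2
  · intro x hx y hy h1 h2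
    simpa using hright x hx y hy h1 h2
  · intro x hx y hy z hz h1 h2 h3
    exact not_lt.2 (hchain x hx y hy z hz h1 h2 h3)

theorem homogeneousSubmodule_le_standardSpan_sup (k : ℕ) :
    homogeneousSubmodule (Fin (n - n₁) × Fin n₂) F k ≤ standardSpan F n n₁ n₂ k ⊔
      Submodule.restrictScalars F (detIdeal F n n₁ n₂) := by
  intro p hp
  rw [p.as_sum]
  refine Submodule.sum_mem _ fun d hd => ?_
  have hdeg : (Finsupp.toMultiset d).card = k := by
    rw [Finsupp.card_toMultiset, ← hp (mem_support_iff.1 hd), Finsupp.weight_apply]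
    simp [Finsupp.sum]
  have h := prod_map_X_mem_standardSpan_sup F (Finsupp.toMultiset d)
  rw [hdeg] at h
  convert Submodule.smul_mem _ (coeff d p) h using 1
  rw [monomial_eq, Finsupp.toMultiset_map, Finsupp.prod_toMultiset, smul_eq_C_mul,
    Finsupp.prod_mapDomain_index (by simp) (by simp [pow_add])]

theorem standardSpan_le_homogeneousSubmodule (k : ℕ) :
    standardSpan F n n₁ n₂ k ≤ homogeneousSubmodule (Fin (n - n₁) × Fin n₂) F k := by
  refine Submodule.span_le.2 ?_
  rintro _ ⟨⟨m, rfl⟩, -, rfl⟩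
  induction m using Multiset.induction with
  | empty => exact isHomogeneous_one _ F
  | cons x m ih =>
    have h := (isHomogeneous_X F x).mul ih
    simpa [add_comm] using h

theorem hilbFn_le_standardCount (k : ℕ) :
    hilbFn F n n₁ n₂ k ≤ standardCount Finset.univ {i : Fin (n - n₁) | n₂ - n₁ ≤ (i : ℕ)}
      {j : Fin n₂ | (j : ℕ) < n₁} Finset.univ k := by
  have := finite_homogeneousSubmodule (F := F) (σ := Fin (n - n₁) × Fin n₂) k
  have hle := standardSpan_le_homogeneousSubmodule F (n := n) (n₁ := n₁) (n₂ := n₂) k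
  rw [hilbFn, standardCount]
  set H := homogeneousSubmodule (Fin (n - n₁) × Fin n₂) F k
  set K := Submodule.comap H.subtype (Submodule.restrictScalars F (detIdeal F n n₁ n₂))
  have := Submodule.finiteDimensional_of_le hle
  have hsurj : Function.Surjective (K.mkQ ∘ₗ Submodule.inclusion hle) := by
    intro y
    obtain ⟨⟨x, hx⟩, rfl⟩ := K.mkQ_surjective y
    obtain ⟨s, hs, r, hr, rfl⟩ :=
      Submodule.mem_sup.1 (homogeneousSubmodule_le_standardSpan_sup F k hx)
    refine ⟨⟨s, hs⟩, ?_⟩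
    rw [LinearMap.comp_apply, Submodule.mkQ_apply, Submodule.mkQ_apply,
      Submodule.Quotient.eq]
    change s - (s + r) ∈ detIdeal F n n₁ n₂
    simpa using hr
  refine (LinearMap.finrank_le_finrank_of_surjective hsurj).trans ?_
  have := Fintype.ofFinite ((fun m : Sym (Fin (n - n₁) × Fin n₂) k =>
    (Multiset.map (X : _ → MvPolynomial _ F) m.1).prod) ''
    {m | IsStandard Finset.univ {i : Fin (n - n₁) | n₂ - n₁ ≤ (i : ℕ)}
      {j : Fin n₂ | (j : ℕ) < n₁} Finset.univ (m : Multiset (Fin (n - n₁) × Fin n₂))})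
  refine (finrank_span_le_card _).trans ?_
  rw [← Set.ncard_eq_toFinset_card']
  exact Set.ncard_image_le

end HilbertFunction

section Degree

theorem Nat.choosePred_eq_choose {n k l : ℕ} (h : k + l = n + 1) :
    choosePred n k = n.choose l := by
  cases k with
  | zero => rw [show l = n + 1 by omega, Nat.choose_succ_self]; rfl
  | succ k => exact Nat.choose_symm_of_eq_add (by omega)

theorem Nat.cast_add_one_mul_choose_succ {n k : ℕ} (h : k ≤ n) :
    ((k : ℚ) + 1) * n.choose (k + 1) = (n - k) * n.choose k := by
  have := Nat.choose_succ_right_eq n k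
  rw [← Nat.cast_sub h]
  exact_mod_cast (by linarith)

theorem degreeCoeff_of_lt {N u v : ℕ} (huv : u < v) (hv : v ≤ N) :
    (degreeCoeff (v - u) (u + 1) (N - v) (v - u) : ℚ) =
      (((N : ℚ) + 1) / (u + 1) - (N + 1) / (v + 1)) * N.choose u * N.choose v := by
  have hu := Nat.cast_add_one_mul_choose_succ (huv.le.trans hv)
  have hv' := Nat.cast_add_one_mul_choose_succ hv
  rw [degreeCoeff, show v - u + (N - v) + (u + 1) - 1 = N by omega,
    show N - v + (u + 1) + (v - u) - 1 = N by omega,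
    Nat.choosePred_eq_choose (show u + 1 + (N - u) = N + 1 by omega),
    Nat.choosePred_eq_choose (show N - v + (v + 1) = N + 1 by omega),
    Nat.choose_symm hv, Nat.choose_symm (huv.le.trans hv)]
  push_cast
  field_simp
  linear_combination ((v : ℚ) + 1) * N.choose v * hu - (u + 1) * N.choose u * hv'

theorem degreeCoeff_generic_erase {M u : ℕ} (h : u ≤ M) :
    (degreeCoeff 1 (u + 1) (M - u) 0 : ℚ) =
      1 / (u + 1) * M.choose u * (M + 1).choose u := by
  have h1 := Nat.cast_add_one_mul_choose_succ h
  have h2 := Nat.cast_add_one_mul_choose_succ (h.trans (Nat.le_succ M))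
  rw [degreeCoeff, show 1 + (M - u) + (u + 1) - 1 = M + 1 by omega,
    show M - u + (u + 1) + 0 - 1 = M by omega,
    Nat.choosePred_eq_choose (show u + 1 + (M + 1 - u) = M + 1 + 1 by omega),
    Nat.choosePred_eq_choose (show M - u + (u + 1) = M + 1 by omega),
    Nat.choose_symm h, Nat.choose_symm (h.trans (Nat.le_succ M))]
  push_cast at h2 ⊢
  field_simp
  linear_combination (M.choose u : ℚ) * h2 - (M + 1).choose u * h1

theorem factorial_mul_leadingCoeff_eq_degreeCoeff {F : Type*} [Field F] {n n₁ n₂ : ℕ}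
    {P P' : Finset (Fin (n - n₁))} {Q Q' : Finset (Fin n₂)} (hP : P' ⊆ P) (hQ : Q ⊆ Q')
    (hP' : ∀ i ∈ P', n₂ - n₁ ≤ (i : ℕ)) (hQ' : ∀ j ∈ Q, (j : ℕ) < n₁)
    (hPlt : ∀ i ∈ P \ P', ∀ i' ∈ P', i < i') (hQlt : ∀ j ∈ Q, ∀ j' ∈ Q' \ Q, j < j')
    (himp : ∀ m, IsStandard Finset.univ {i : Fin (n - n₁) | n₂ - n₁ ≤ (i : ℕ)}
      {j : Fin n₂ | (j : ℕ) < n₁} Finset.univ m → IsStandard P P' Q Q' m)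
    {a β ρ c : ℕ} (ha : (P \ P').card = a) (hβ : Q.card = β + 1) (hρ : P'.card = ρ + 1)
    (hc : (Q' \ Q).card = c) (hD : 0 < (degreeCoeff a β ρ c : ℚ)) {p : Polynomial ℚ}
    (hp : ∀ᶠ k in Filter.atTop, (hilbFn F n n₁ n₂ k : ℚ) = p.eval (k : ℚ)) :
    (Nat.factorial p.natDegree : ℚ) * p.leadingCoeff = degreeCoeff a β ρ c :=
  factorial_natDegree_mul_leadingCoeff (by exact_mod_cast hD)
    ((upperGrowth_standardCount hP hQ hPlt hQlt ha hβ hρ hc).mono fun k =>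
      (hilbFn_le_standardCount F k).trans (standardCount_le_of_imp himp k))
    ((lowerGrowth_factorMap F hP hQ ha hβ hρ hc).mono
      (finrank_imagePart_le_hilbFn F hP' hQ')) hp

end Degree

/-- Corollary 2.4 of the paper: the degree of the associated variety, i.e.
`(deg p)!` times the leading coefficient of the Hilbert polynomial `p`. -/
theorem degree_of_variety {F : Type*} [Field F] [CharZero F] (n n₁ n₂ : ℕ)
    (h1 : 1 ≤ n₁) (h2 : n₁ ≤ n₂) (h3 : n₂ < n)
    (p : Polynomial ℚ)
    (hp : ∀ᶠ k in Filter.atTop, (hilbFn F n n₁ n₂ k : ℚ) = p.eval (k : ℚ)) :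
    (2 ≤ n₁ → n₁ < n₂ →
      (Nat.factorial p.natDegree : ℚ) * p.leadingCoeff =
        (((n : ℚ) - 2) / ((n₁ : ℚ) - 1) - ((n : ℚ) - 2) / ((n₂ : ℚ) - 1)) *
          (Nat.choose (n - 3) (n₁ - 2) : ℚ) * (Nat.choose (n - 3) (n₂ - 2) : ℚ)) ∧
    (1 < n₁ → n₁ = n₂ → n₂ < n - 1 →
      (Nat.factorial p.natDegree : ℚ) * p.leadingCoeff =
        (1 / ((n₁ : ℚ) - 1)) *
          (Nat.choose (n - 4) (n₁ - 2) : ℚ) * (Nat.choose (n - 3) (n₁ - 2) : ℚ)) ∧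
    ((n₁ = 1 ∧ n₂ = 1) ∨ (n₁ = n - 1 ∧ n₂ = n - 1) →
      (Nat.factorial p.natDegree : ℚ) * p.leadingCoeff = 1) := by
  refine ⟨fun h4 h5 => ?_, fun h4 h5 h6 => ?_, fun h4 => ?_⟩
  · obtain ⟨u, rfl⟩ := Nat.exists_eq_add_of_le' h4
    obtain ⟨v, rfl⟩ : ∃ v, n₂ = v + 2 := Nat.exists_eq_add_of_le' (by omega)
    obtain ⟨N, rfl⟩ : ∃ N, n = N + 3 := Nat.exists_eq_add_of_le' (by omega)
    have huv : u < v := by omega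
    have hD := degreeCoeff_of_lt huv (show v ≤ N by omega)
    have hcardP : ({i : Fin (N + 3 - (u + 2)) | v + 2 - (u + 2) ≤ (i : ℕ)} : Finset _).card =
        N - v + 1 := by
      have h := Finset.card_filter_add_card_filter_not (s := Finset.univ)
        fun i : Fin (N + 3 - (u + 2)) => (i : ℕ) < v + 2 - (u + 2)
      rw [Fin.card_filter_val_lt, Finset.card_fin] at h
      simp only [not_lt] at h
      omega
    have hcardQ : ({j : Fin (v + 2) | (j : ℕ) < u + 2} : Finset _).card = u + 1 + 1 := by
      rw [Fin.card_filter_val_lt]; omega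
    rw [factorial_mul_leadingCoeff_eq_degreeCoeff (F := F) (Finset.subset_univ _)
      (Finset.subset_univ _) (by simp) (by simp) ?_ ?_ (fun m hm => hm)
      (a := v - u) (c := v - u) ?_ hcardQ hcardP ?_ ?_ hp, hD]
    · push_cast
      ring
    · intro i hi i' hi'
      simp only [Finset.mem_sdiff, Finset.mem_univ, Finset.mem_filter, true_and] at hi hi'
      omega
    · intro i hi i' hi'
      simp only [Finset.mem_sdiff, Finset.mem_univ, Finset.mem_filter, true_and] at hi hi'
      omega
    · rw [Finset.card_sdiff_of_subset (Finset.subset_univ _), hcardP, Finset.card_fin]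
      omega
    · rw [Finset.card_sdiff_of_subset (Finset.subset_univ _), hcardQ, Finset.card_fin]
      omega
    · rw [hD]
      have h7 : ((N : ℚ) + 1) / (v + 1) < (N + 1) / (u + 1) := by gcongr
      have h8 : 0 < N.choose u := Nat.choose_pos (by omega)
      have h9 : 0 < N.choose v := Nat.choose_pos (by omega)
      have h10 := sub_pos.2 h7
      positivity
  · subst h5
    obtain ⟨u, rfl⟩ : ∃ u, n₁ = u + 2 := Nat.exists_eq_add_of_le' (by omega)
    obtain ⟨M, rfl⟩ : ∃ M, n = M + 4 := Nat.exists_eq_add_of_le' (by omega)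
    have hD := degreeCoeff_generic_erase (show u ≤ M by omega)
    rw [factorial_mul_leadingCoeff_eq_degreeCoeff (F := F) (P := Finset.univ)
      (P' := Finset.univ.erase ⟨0, by omega⟩) (Q := Finset.univ) (Q' := Finset.univ)
      (Finset.subset_univ _) (Finset.subset_univ _) (by simp) (by simp) ?_ (by simp)
      (fun m hm => ?_) (a := 1) (c := 0) (β := u + 1) (ρ := M - u) ?_ (by simp) ?_ (by simp) ?_ hp,
      hD]
    · push_cast
      ring
    · intro i hi i' hi'
      simp [Fin.ext_iff] at hi hi'
      omega
    · rw [Finset.sdiff_erase (Finset.mem_univ _), sdiff_self, Finset.bot_eq_empty,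
        insert_empty_eq, Finset.card_singleton]
    · rw [Finset.card_erase_of_mem (Finset.mem_univ _), Finset.card_fin]
      omega
    · rw [hD]
      have h8 : 0 < M.choose u := Nat.choose_pos (by omega)
      have h9 : 0 < (M + 1).choose u := Nat.choose_pos (by omega)
      positivity
    · exact IsStandard.erase_min (by simpa using hm) fun i _ => Nat.zero_le i
  · obtain rfl : n₁ = n₂ := by omega
    rcases h4 with ⟨rfl, -⟩ | ⟨hn, -⟩
    · rw [factorial_mul_leadingCoeff_eq_degreeCoeff (F := F) (P := Finset.univ)
        (P' := {⟨n - 2, by omega⟩}) (Q := Finset.univ) (Q' := Finset.univ)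
        (Finset.subset_univ _) (Finset.subset_univ _) (by simp) (by simp) ?_ (by simp)
        (fun m hm => ?_) (a := n - 2) (β := 0) (ρ := 0) (c := 0) ?_ (by simp) (by simp) (by simp)
        ?_ hp, degreeCoeff_zero_zero, Int.cast_one]
      · intro i hi i' hi'
        simp [Fin.ext_iff] at hi hi'
        omega
      · rw [Finset.card_sdiff_of_subset (Finset.subset_univ _), Finset.card_fin,
          Finset.card_singleton]
        omega
      · rw [degreeCoeff_zero_zero]
        simp
      · exact ⟨by simp, fun x _ y _ _ h => absurd h (by omega), by simp, hm.chain⟩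
    · obtain rfl : n = n₁ + 1 := by omega
      rw [factorial_mul_leadingCoeff_eq_degreeCoeff (F := F) (P := Finset.univ)
        (P' := Finset.univ) (Q := {⟨0, h1⟩}) (Q' := Finset.univ)
        (Finset.subset_univ _) (Finset.subset_univ _) (by simp) (by simp) (by simp) ?_
        (fun m hm => ?_) (a := 0) (β := 0) (ρ := 0) (c := n₁ - 1) (by simp) (by simp) (by simp) ?_
        ?_ hp, degreeCoeff_zero_zero, Int.cast_one]
      · intro i hi i' hi'
        simp [Fin.ext_iff] at hi hi'
        omega
      · rw [Finset.card_sdiff_of_subset (Finset.subset_univ _), Finset.card_fin,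
          Finset.card_singleton]
      · rw [degreeCoeff_zero_zero]
        simp
      · exact ⟨by simp, by simp, fun x _ y _ h => absurd h (by omega), hm.chain⟩
end

section
/- (Proposition 2.3, leading coefficient of P_1.) Let m, n ≥ 1 be integers and 1 ≤ ξ ≤ n. Let p ∈ ℚ[r] be the polynomial with P_1(m,n,ξ,r) = p(r) for all sufficiently large r. Then (deg p)! times the leading coefficient of p equals: 1 if m = 1 or n < 3; (1/(n−1))·C(m+n−4,m−2)·C(m+n−3,n−2) if ξ = 1, m ≥ 2 and n ≥ 3; and ((ξ−1)/(n−1))·C(m+n−ξ−2,m−2)·C(m+n−3,n−2) in all remaining cases. -/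
/-- A multiset of pairs of positive integers contains a 2-chain:
two elements (at distinct positions) with both coordinates strictly increasing. -/
def Has2Chain (S : Multiset (ℕ × ℕ)) : Prop :=
  ∃ a ∈ S, ∃ b ∈ S, a.1 < b.1 ∧ a.2 < b.2

/-- A multiset of pairs contains a 3-chain:
three elements with both coordinates strictly increasing. -/
def Has3Chain (S : Multiset (ℕ × ℕ)) : Prop :=
  ∃ a ∈ S, ∃ b ∈ S, ∃ c ∈ S, a.1 < b.1 ∧ b.1 < c.1 ∧ a.2 < b.2 ∧ b.2 < c.2

/-- The index multiset of a degree-`r` monomial in the variables `z_{i,j}`,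
`1 ≤ i ≤ m`, `1 ≤ j ≤ n`, with 1-indexed entries. -/
def idxMS (m n r : ℕ) (f : Sym (Fin m × Fin n) r) : Multiset (ℕ × ℕ) :=
  Multiset.map (fun p => (p.1.1 + 1, p.2.1 + 1)) (f : Multiset (Fin m × Fin n))

/-- `P1 m n ξ r`: number of degree-`r` monomials in the `m × n` grid of variables
whose index multiset contains no 3-chain and whose part with column index `< ξ`
contains no 2-chain. -/
noncomputable def P1 (m n ξ r : ℕ) : ℕ :=
  Nat.card {f : Sym (Fin m × Fin n) r //
    ¬ Has3Chain (idxMS m n r f) ∧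
    ¬ Has2Chain ((idxMS m n r f).filter (fun p => p.2 < ξ)) }

theorem card_sym_toFinset_eq {α : Type*} [DecidableEq α] [Fintype α] (F : Finset α)
    (hF : F.Nonempty) {r : ℕ} (hr : F.card ≤ r) :
    (Finset.univ.filter fun f : Sym α r => (f : Multiset α).toFinset = F).card =
      (r - F.card + (F.card - 1)).choose (F.card - 1) := by
  have hpos := hF.card_pos
  have key : (Finset.univ : Finset (Sym F (r - F.card))).card =
      (Finset.univ.filter fun f : Sym α r => (f : Multiset α).toFinset = F).card := by
    refine Finset.card_bij
      (fun g _ => Sym.mk ((g : Multiset F).map Subtype.val + F.val) (by simp; omega)) ?_ ?_ ?_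
    · intro g _
      simp only [Finset.mem_filter, Finset.mem_univ, true_and]
      ext x
      simp only [Multiset.mem_toFinset, Sym.coe_mk, Multiset.mem_add, Multiset.mem_map]
      constructor
      · rintro (⟨y, -, rfl⟩ | h)
        · exact y.2
        · exact h
      · exact Or.inr
    · intro g _ g' _ h
      have h' := congrArg Subtype.val h
      simp only [add_left_inj] at h'
      exact Subtype.ext (Multiset.map_injective Subtype.val_injective h')
    · intro f hf
      simp only [Finset.mem_filter, Finset.mem_univ, true_and] at hf
      have hle : F.val ≤ (f : Multiset α) := by
        rw [← hf, Multiset.toFinset_val]; exact Multiset.dedup_le _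
      have hmem : ∀ x ∈ (f : Multiset α) - F.val, x ∈ F := fun x hx => by
        rw [← hf, Multiset.mem_toFinset]
        exact Multiset.mem_of_le (Multiset.sub_le_self _ _) hx
      obtain ⟨g, hg⟩ : ∃ g : Multiset F, g.map Subtype.val = (f : Multiset α) - F.val :=
        CanLift.prf _ hmem
      refine ⟨Sym.mk g ?_, Finset.mem_univ _, ?_⟩
      · rw [← Multiset.card_map Subtype.val, hg, Multiset.card_sub hle]
        simp
      · apply Subtype.ext
        simp only [Sym.coe_mk, hg]
        exact Multiset.sub_add_cancel hle
  rw [← key, Finset.card_univ, Sym.card_sym_eq_choose, Fintype.card_coe,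
    show F.card + (r - F.card) - 1 = r - F.card + (F.card - 1) by omega, ← Nat.choose_symm_add]

open Polynomial in
/-- If a class `Φ` of supports has `N > 0` members of the largest size `D`, then the polynomial
counting monomials with support in `Φ` has normalized leading coefficient `N`. -/
theorem factorial_mul_leadingCoeff_of_support {α : Type*} [DecidableEq α] [Fintype α]
    (Φ : Finset α → Prop) [DecidablePred Φ] {D N : ℕ} (hD : 0 < D) (hN : 0 < N)
    (hle : ∀ F, Φ F → F.card ≤ D)
    (hcard : (Finset.univ.filter fun F => Φ F ∧ F.card = D).card = N) (p : ℚ[X])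
    (hp : ∀ᶠ r : ℕ in Filter.atTop,
      ((Finset.univ.filter fun f : Sym α r => Φ (f : Multiset α).toFinset).card : ℚ) =
        p.eval (r : ℚ)) :
    (Nat.factorial p.natDegree : ℚ) * p.leadingCoeff = N := by
  obtain ⟨d, rfl⟩ := Nat.exists_eq_add_of_lt hD
  rw [zero_add] at *
  set s : Finset (Finset α) := Finset.univ.filter fun F => Φ F ∧ F.Nonempty
  have hcount : ∀ r : ℕ, Fintype.card α < r →
      ((Finset.univ.filter fun f : Sym α r => Φ (f : Multiset α).toFinset).card : ℚ) =
        (∑ F ∈ s, preHilbertPoly ℚ (F.card - 1) F.card).eval (r : ℚ) := by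
    intro r hr
    rw [eval_finsetSum, Finset.card_eq_sum_card_fiberwise
      (f := fun f : Sym α r => (f : Multiset α).toFinset) (t := s)]
    · push_cast
      refine Finset.sum_congr rfl fun F hF => ?_
      simp only [s, Finset.mem_filter, Finset.mem_univ, true_and] at hF
      have hFr : F.card ≤ r := (Finset.card_le_univ F).trans hr.le
      rw [preHilbertPoly_eq_choose_sub_add _ _ hFr, ← card_sym_toFinset_eq F hF.2 hFr,
        Finset.filter_filter]
      congr 2
      ext f
      simp only [Finset.mem_filter, Finset.mem_univ, true_and, and_iff_right_iff_imp]
      rintro rfl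
      exact hF.1
    · intro f hf
      simp only [Finset.coe_filter, Finset.mem_univ, true_and, Set.mem_ofPred_eq, s] at hf ⊢
      refine ⟨hf, ?_⟩
      rw [Multiset.toFinset_nonempty]
      intro h
      have := Sym.card_coe (s := f)
      rw [h, Multiset.card_zero] at this
      omega
  have hpeq : p = ∑ F ∈ s, preHilbertPoly ℚ (F.card - 1) F.card := by
    obtain ⟨a, ha⟩ := Filter.eventually_atTop.1 hp
    refine Polynomial.eq_of_infinite_eval_eq _ _ (Set.Infinite.mono
      (s := Nat.cast '' Set.Ioi (max a (Fintype.card α))) ?_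
      ((Set.Ioi_infinite _).image Nat.cast_injective.injOn))
    rintro _ ⟨r, hr, rfl⟩
    simp only [Set.mem_Ioi, sup_lt_iff] at hr
    exact (ha r hr.1.le).symm.trans (hcount r hr.2)
  have hdeg : p.natDegree ≤ d := by
    rw [hpeq]
    refine natDegree_sum_le_of_forall_le _ _ fun F hF => ?_
    rw [natDegree_preHilbertPoly]
    have := hle F (Finset.mem_filter.1 hF).2.1
    omega
  have hcoeff : p.coeff d = N * (d.factorial : ℚ)⁻¹ := by
    rw [hpeq, finsetSum_coeff, ← hcard, ← Finset.sum_filter_add_sum_filter_not s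
      (fun F => F.card = d + 1)]
    rw [Finset.sum_congr rfl (g := fun _ => (d.factorial : ℚ)⁻¹), Finset.sum_const, nsmul_eq_mul,
      Finset.sum_eq_zero, add_zero]
    · congr 3
      ext F
      simp only [s, Finset.mem_filter, Finset.mem_univ, true_and]
      constructor
      · exact fun h => ⟨h.1.1, h.2⟩
      · exact fun h => ⟨⟨h.1, Finset.card_pos.1 (by omega)⟩, h.2⟩
    · intro F hF
      simp only [s, Finset.mem_filter, Finset.mem_univ, true_and] at hF
      refine coeff_eq_zero_of_natDegree_lt ?_
      rw [natDegree_preHilbertPoly]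
      have := hle F hF.1.1
      have := hF.1.2.card_pos
      omega
    · intro F hF
      rw [(Finset.mem_filter.1 hF).2, Nat.add_sub_cancel, coeff_preHilbertPoly_self]
  have hne : p.coeff d ≠ 0 := by rw [hcoeff]; positivity
  rw [leadingCoeff, natDegree_eq_of_le_of_coeff_ne_zero hdeg hne, hcoeff]
  field_simp

/-- The top row of a column set `T`, capped by `a`. -/
def topRow {m : ℕ} (a : Fin m) (T : Finset (Fin m)) : Fin m :=
  (insert a T).min' (Finset.insert_nonempty a T)

theorem topRow_le {m : ℕ} (a : Fin m) (T : Finset (Fin m)) : topRow a T ≤ a :=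
  Finset.min'_le _ _ (Finset.mem_insert_self _ _)

theorem topRow_le_of_mem {m : ℕ} {a t : Fin m} {T : Finset (Fin m)} (h : t ∈ T) :
    topRow a T ≤ t :=
  Finset.min'_le _ _ (Finset.mem_insert_of_mem h)

theorem le_topRow_iff {m : ℕ} {a t : Fin m} {T : Finset (Fin m)} :
    t ≤ topRow a T ↔ t ≤ a ∧ ∀ x ∈ T, t ≤ x := by
  simp [topRow, Finset.le_min'_iff]

theorem topRow_lt_iff {m : ℕ} {a t : Fin m} {T : Finset (Fin m)} :
    topRow a T < t ↔ a < t ∨ ∃ x ∈ T, x < t := by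
  rw [← not_iff_not, not_lt, le_topRow_iff]
  simp

/-- `f j` is the set of rows occupied in column `j`. Relative to earlier columns with top row `a`
and no `2`-chain ending above row `b`, the columns of `f` create no `3`-chain, and the first `k` of
them create no `2`-chain. -/
def IsLayered {m q : ℕ} (k : ℕ) (a b : Fin m) (f : Fin q → Finset (Fin m)) : Prop :=
  (∀ j, ∀ t ∈ f j, t ≤ b) ∧
  (∀ j : Fin q, j.val < k → ∀ t ∈ f j, t ≤ a) ∧
  (∀ j j' : Fin q, j < j' → j'.val < k → ∀ t ∈ f j, ∀ t' ∈ f j', t' ≤ t) ∧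
  (∀ j j' : Fin q, j < j' → ∀ t ∈ f j, ∀ t' ∈ f j', a < t → t' ≤ t) ∧
  (∀ i j l : Fin q, i < j → j < l → ∀ t ∈ f i, ∀ t' ∈ f j, ∀ t'' ∈ f l, t < t' → t'' ≤ t')

theorem isLayered_zero_cons {m q : ℕ} {a b : Fin m} {T : Finset (Fin m)}
    {g : Fin q → Finset (Fin m)} :
    IsLayered 0 a b (Fin.cons T g : Fin (q + 1) → Finset (Fin m)) ↔
      (∀ t ∈ T, t ≤ b) ∧ IsLayered 0 (topRow a T) (topRow b (T.filter (a < ·))) g := by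
  simp only [IsLayered, Fin.forall_fin_succ, Fin.cons_zero, Fin.cons_succ, Fin.succ_lt_succ_iff,
    Fin.succ_pos, topRow_lt_iff, le_topRow_iff,
    Finset.mem_filter, not_lt_zero, false_imp_iff, true_imp_iff, implies_true, true_and]
  constructor
  · rintro ⟨⟨h1, h2⟩, ⟨h3, h4⟩, h5, h6⟩
    refine ⟨h1, fun j t ht => ⟨h2 j t ht, fun x hx => h3 j x hx.1 t ht hx.2⟩, ?_, h6⟩
    rintro j j' hj t ht t' ht' (h | ⟨x, hx, h⟩)
    · exact h4 j j' hj t ht t' ht' h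
    · exact h5 j j' hj x hx t ht t' ht' h
  · rintro ⟨h1, h2, h3, h4⟩
    exact ⟨⟨h1, fun j t ht => (h2 j t ht).1⟩,
      ⟨fun j x hx t ht h => (h2 j t ht).2 x ⟨hx, h⟩,
        fun j j' hj t ht t' ht' h => h3 j j' hj t ht t' ht' (Or.inl h)⟩,
      fun j j' hj x hx t ht t' ht' h => h3 j j' hj t ht t' ht' (Or.inr ⟨x, hx, h⟩), h4⟩

theorem isLayered_succ_cons {m q k : ℕ} {a b : Fin m} (hab : a ≤ b) {T : Finset (Fin m)}
    {g : Fin q → Finset (Fin m)} :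
    IsLayered (k + 1) a b (Fin.cons T g : Fin (q + 1) → Finset (Fin m)) ↔
      (∀ t ∈ T, t ≤ a) ∧ IsLayered k (topRow a T) b g := by
  simp only [IsLayered, Fin.forall_fin_succ, Fin.cons_zero, Fin.cons_succ, Fin.succ_lt_succ_iff,
    Fin.succ_pos, Fin.not_lt_zero, topRow_lt_iff, le_topRow_iff,
    Fin.val_succ, Fin.val_zero, add_lt_add_iff_right, Nat.succ_pos,
    false_imp_iff, true_imp_iff, implies_true, true_and]
  constructor
  · rintro ⟨⟨h1, h2⟩, ⟨h3, h4⟩, ⟨h5, h6⟩, ⟨h7, h8⟩, h9, h10⟩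
    refine ⟨h3, h2, fun j hj t ht => ⟨h4 j hj t ht, fun x hx => h5 j hj x hx t ht⟩, h6, ?_, h10⟩
    rintro j j' hj t ht t' ht' (h | ⟨x, hx, h⟩)
    · exact h8 j j' hj t ht t' ht' h
    · exact h9 j j' hj x hx t ht t' ht' h
  · rintro ⟨h1, h2, h3, h4, h5, h6⟩
    exact ⟨⟨fun t ht => (h1 t ht).trans hab, h2⟩, ⟨h1, fun j hj t ht => (h3 j hj t ht).1⟩,
      ⟨fun j hj x hx t ht => (h3 j hj t ht).2 x hx, h4⟩,
      ⟨fun j x hx t ht h => absurd (h1 x hx) (not_le.2 h),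
        fun j j' hj t ht t' ht' h => h5 j j' hj t ht t' ht' (Or.inl h)⟩,
      fun j j' hj x hx t ht t' ht' h => h5 j j' hj t ht t' ht' (Or.inr ⟨x, hx, h⟩), h6⟩

theorem eq_Icc_of_le {m : ℕ} {a : Fin m} {T : Finset (Fin m)} (hT : ∀ t ∈ T, t ≤ a) :
    T.card + topRow a T ≤ a + 1 ∧ (T.card + topRow a T = a + 1 → T = Finset.Icc (topRow a T) a) := by
  have hsub : T ⊆ Finset.Icc (topRow a T) a := fun t ht =>
    Finset.mem_Icc.2 ⟨topRow_le_of_mem ht, hT t ht⟩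
  have hle : (topRow a T : ℕ) ≤ a := topRow_le a T
  have hcard := Finset.card_le_card hsub
  have heq := Fin.card_Icc (topRow a T) a
  refine ⟨by omega, fun h => Finset.eq_of_subset_of_card_le hsub (by omega)⟩

theorem eq_Icc_union_Icc_of_le {m : ℕ} {a b : Fin m} (hab : a ≤ b) {T : Finset (Fin m)}
    (hT : ∀ t ∈ T, t ≤ b) :
    T.card + topRow a T + topRow b (T.filter (a < ·)) ≤ a + b + 2 ∧
      (T.card + topRow a T + topRow b (T.filter (a < ·)) = a + b + 2 →
        a < topRow b (T.filter (a < ·)) ∧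
        T = Finset.Icc (topRow a T) a ∪ Finset.Icc (topRow b (T.filter (a < ·))) b) := by
  have hleB : (topRow b (T.filter (a < ·)) : ℕ) ≤ b := topRow_le _ _
  rcases hab.eq_or_lt with rfl | hab
  · have h := (eq_Icc_of_le hT).1
    exact ⟨by omega, fun h' => by omega⟩
  · have hsub : T ⊆ Finset.Icc (topRow a T) a ∪ Finset.Icc (topRow b (T.filter (a < ·))) b := by
      intro t ht
      rw [Finset.mem_union, Finset.mem_Icc, Finset.mem_Icc]
      rcases le_or_gt t a with h | h
      · exact Or.inl ⟨topRow_le_of_mem ht, h⟩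
      · exact Or.inr ⟨topRow_le_of_mem (Finset.mem_filter.2 ⟨ht, h⟩), hT t ht⟩
    have hleA : (topRow a T : ℕ) ≤ a := topRow_le a T
    have hcard := (Finset.card_le_card hsub).trans (Finset.card_union_le _ _)
    have heqA := Fin.card_Icc (topRow a T) a
    have heqB := Fin.card_Icc (topRow b (T.filter (a < ·))) b
    have hu := Finset.card_union_le (Finset.Icc (topRow a T) a)
      (Finset.Icc (topRow b (T.filter (a < ·))) b)
    refine ⟨by omega, fun h => ⟨?_, Finset.eq_of_subset_of_card_le hsub (by omega)⟩⟩
    rw [← not_le]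
    intro h'
    have := (le_topRow_iff (a := b) (T := T.filter (a < ·)) (t := ⟨a + 1, by omega⟩)).2
      ⟨Fin.mk_le_of_le_val (by omega), fun x hx =>
        Fin.mk_le_of_le_val (Nat.succ_le_of_lt (Finset.mem_filter.1 hx).2)⟩
    have : (a : ℕ) + 1 ≤ topRow b (T.filter (a < ·)) := this
    have : (topRow b (T.filter (a < ·)) : ℕ) ≤ a := h'
    omega

theorem topRow_Icc {m : ℕ} {x a : Fin m} (h : x ≤ a) : topRow a (Finset.Icc x a) = x :=
  le_antisymm (topRow_le_of_mem (Finset.left_mem_Icc.2 h))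
    (le_topRow_iff.2 ⟨h, fun _ hy => (Finset.mem_Icc.1 hy).1⟩)

theorem topRow_Icc_union {m : ℕ} {x a y b : Fin m} (hx : x ≤ a) (hy : a < y) :
    topRow a (Finset.Icc x a ∪ Finset.Icc y b) = x := by
  refine le_antisymm (topRow_le_of_mem (Finset.mem_union_left _ (Finset.left_mem_Icc.2 hx)))
    (le_topRow_iff.2 ⟨hx, fun t ht => ?_⟩)
  rcases Finset.mem_union.1 ht with h | h
  · exact (Finset.mem_Icc.1 h).1
  · exact (hx.trans hy.le).trans (Finset.mem_Icc.1 h).1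

theorem filter_Icc_union {m : ℕ} {x a y b : Fin m} (hy : a < y) :
    (Finset.Icc x a ∪ Finset.Icc y b).filter (a < ·) = Finset.Icc y b := by
  ext t
  simp only [Finset.mem_filter, Finset.mem_union, Finset.mem_Icc]
  constructor
  · rintro ⟨h | h, h'⟩
    · exact absurd h.2 (not_le.2 h')
    · exact h
  · exact fun h => ⟨Or.inr h, hy.trans_le h.1⟩

theorem card_Icc_union {m : ℕ} {x a y b : Fin m} (hx : x ≤ a) (hy : a < y) (hb : y ≤ b) :
    (Finset.Icc x a ∪ Finset.Icc y b).card + x + y = a + b + 2 := by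
  rw [Finset.card_union_of_disjoint, Fin.card_Icc, Fin.card_Icc]
  · have hx' : (x : ℕ) ≤ a := hx
    have hb' : (y : ℕ) ≤ b := hb
    omega
  · rw [Finset.disjoint_left]
    intro t ht ht'
    exact absurd ((Finset.mem_Icc.1 ht').1.trans (Finset.mem_Icc.1 ht).2) (not_le.2 hy)

/-- The number of weakly decreasing sequences with `q` steps from `x` to `1`. -/
def multichoosePred (q : ℕ) : ℕ → ℕ
  | 0 => 0
  | x + 1 => q.multichoose x

theorem sum_range_multichoose (q a : ℕ) :
    ∑ x ∈ Finset.range (a + 1), q.multichoose x = (q + 1).multichoose a := by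
  induction a with
  | zero => simp
  | succ a ih => rw [Finset.sum_range_succ, ih, Nat.multichoose_succ_succ, add_comm]

theorem sum_range_multichoosePred (q a : ℕ) :
    ∑ x ∈ Finset.range (a + 1), multichoosePred q x = multichoosePred (q + 1) a := by
  rw [Finset.sum_range_succ']
  cases a with
  | zero => simp [multichoosePred]
  | succ a => simpa [multichoosePred] using sum_range_multichoose q a

theorem sum_Iic_val {m : ℕ} (F : ℕ → ℤ) (a : Fin m) :
    ∑ x ∈ Finset.Iic a, F x = ∑ x ∈ Finset.range (a + 1), F x := by
  have h : Finset.range (a + 1) = Finset.Iic (a : ℕ) := by ext; simp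
  rw [h, ← Fin.map_valEmbedding_Iic, Finset.sum_map]
  rfl

theorem sum_Ioc_val {m : ℕ} (F : ℕ → ℤ) {a b : Fin m} (hab : a ≤ b) :
    ∑ x ∈ Finset.Ioc a b, F x =
      ∑ x ∈ Finset.range (b + 1), F x - ∑ x ∈ Finset.range (a + 1), F x := by
  rw [← sum_Iic_val, ← sum_Iic_val, eq_sub_iff_add_eq, ← Finset.sum_union]
  · congr 1
    ext t
    simp only [Finset.mem_union, Finset.mem_Ioc, Finset.mem_Iic]
    constructor
    · rintro (h | h)
      · exact h.2
      · exact h.trans hab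
    · exact fun h => (le_or_gt t a).symm.imp (⟨·, h⟩) id
  · rw [Finset.disjoint_left]
    intro t ht ht'
    exact absurd (Finset.mem_Iic.1 ht') (not_le.2 (Finset.mem_Ioc.1 ht).1)

theorem card_filter_cons {α : Type*} [Fintype α] {q : ℕ} (P : (Fin (q + 1) → α) → Prop)
    [DecidablePred P] :
    (Finset.univ.filter P).card =
      ∑ T : α, (Finset.univ.filter fun g : Fin q → α => P (Fin.cons T g)).card := by
  simp only [Finset.card_filter]
  rw [← Fintype.sum_prod_type' (f := fun T (g : Fin q → α) => if P (Fin.cons T g) then 1 else 0)]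
  exact (Fintype.sum_equiv (Fin.consEquiv fun _ => α) _ _ fun _ => rfl).symm

open Classical in
/-- A layered tuple has at most `a + b + 2 * q - k - 1` cells; the tuples attaining this bound are
pairs of non-crossing paths, counted by a determinant. -/
theorem card_isLayered {m : ℕ} (q : ℕ) : ∀ k ≤ q, ∀ a b : Fin m, a ≤ b → 0 < b.val →
    (∀ f : Fin q → Finset (Fin m), IsLayered k a b f →
      ∑ j, (f j).card + 1 + k ≤ a + b + 2 * q) ∧
    ((Finset.univ.filter fun f : Fin q → Finset (Fin m) => IsLayered k a b f ∧
        ∑ j, (f j).card + 1 + k = a + b + 2 * q).card : ℤ) =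
      q.multichoose a * multichoosePred (q - k) b
        - multichoosePred q a * (q - k).multichoose b := by
  induction q with
  | zero =>
    intro k hk a b hab hb
    obtain rfl : k = 0 := by omega
    have hab' : (a : ℕ) ≤ b := hab
    refine ⟨fun f _ => by simp; omega, ?_⟩
    have hV : ∀ f : Fin 0 → Finset (Fin m), IsLayered 0 a b f := fun f => by simp [IsLayered]
    simp only [hV, true_and, Finset.univ_eq_empty, Finset.sum_empty]
    generalize (a : ℕ) = x at *
    generalize (b : ℕ) = y at *
    obtain ⟨y, rfl⟩ := Nat.exists_eq_add_of_lt hb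
    rcases x with _ | _ | x <;> rcases y with _ | y <;>
      simp [multichoosePred]
    omega
  | succ q ih =>
    intro k hk a b hab hb
    have hab' : (a : ℕ) ≤ b := hab
    rcases k with _ | k
    · have hstep : ∀ (T : Finset (Fin m)) (g : Fin q → Finset (Fin m)),
          IsLayered 0 a b (Fin.cons T g : Fin (q + 1) → Finset (Fin m)) →
          T.card + topRow a T + topRow b (T.filter (a < ·)) ≤ a + b + 2 ∧
          (T.card + topRow a T + topRow b (T.filter (a < ·)) = a + b + 2 →
            a < topRow b (T.filter (a < ·)) ∧
            T = Finset.Icc (topRow a T) a ∪ Finset.Icc (topRow b (T.filter (a < ·))) b) ∧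
          ∑ j, (g j).card + 1 ≤ topRow a T + topRow b (T.filter (a < ·)) + 2 * q := by
        intro T g h
        rw [isLayered_zero_cons] at h
        have h1 := eq_Icc_union_Icc_of_le hab h.1
        have hAB : topRow a T ≤ topRow b (T.filter (a < ·)) :=
          le_topRow_iff.2 ⟨(topRow_le a T).trans hab, fun x hx =>
            topRow_le_of_mem (Finset.mem_filter.1 hx).1⟩
        have hB : 0 < (topRow b (T.filter (a < ·))).val := by
          have : (⟨0, by omega⟩ : Fin m) < topRow b (T.filter (a < ·)) := by
            rw [← not_le, ← not_lt, not_not]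
            have : (⟨1, by omega⟩ : Fin m) ≤ topRow b (T.filter (a < ·)) :=
              le_topRow_iff.2 ⟨Fin.mk_le_of_le_val (by omega), fun x hx => by
                have hx' : (a : ℕ) < x := (Finset.mem_filter.1 hx).2
                exact Fin.mk_le_of_le_val (by omega)⟩
            exact lt_of_lt_of_le (Fin.mk_lt_mk.2 one_pos) this
          exact this
        exact ⟨h1.1, h1.2, (ih 0 (Nat.zero_le _) _ _ hAB hB).1 g h.2⟩
      constructor
      · intro f hf
        rw [← Fin.cons_self_tail f] at hf ⊢
        obtain ⟨h1, -, h2⟩ := hstep _ _ hf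
        simp only [Fin.sum_univ_succ, Fin.cons_zero, Fin.cons_succ]
        omega
      · rw [card_filter_cons]
        push_cast
        rw [← Finset.sum_of_injOn (s := Finset.Iic a ×ˢ Finset.Ioc a b)
          (fun z : Fin m × Fin m => Finset.Icc z.1 a ∪ Finset.Icc z.2 b)
          (f := fun z => ((q.multichoose z.1 * multichoosePred q z.2
            - multichoosePred q z.1 * q.multichoose z.2 : ℤ)))]
        · rw [Finset.sum_product]
          simp only [Finset.sum_sub_distrib, ← Finset.mul_sum]
          rw [sum_Ioc_val (fun x => (multichoosePred q x : ℤ)) hab,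
            sum_Ioc_val (fun x => (q.multichoose x : ℤ)) hab,
            ← Finset.sum_mul, ← Finset.sum_mul,
            sum_Iic_val (fun x => (multichoosePred q x : ℤ)),
            sum_Iic_val (fun x => (q.multichoose x : ℤ))]
          simp only [← Nat.cast_sum, sum_range_multichoose, sum_range_multichoosePred]
          ring
        · rintro ⟨x, y⟩ h ⟨x', y'⟩ h' heq
          simp only [Finset.coe_product, Set.mem_prod, Finset.mem_coe, Finset.mem_Iic,
            Finset.mem_Ioc] at h h' heq
          have e1 := congrArg (topRow a) heq
          have e2 := congrArg (fun T => topRow b (T.filter (a < ·))) heq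
          simp only [filter_Icc_union h.2.1, filter_Icc_union h'.2.1, topRow_Icc h.2.2,
            topRow_Icc h'.2.2] at e2
          rw [topRow_Icc_union h.1 h.2.1, topRow_Icc_union h'.1 h'.2.1] at e1
          rw [e1, e2]
        · exact fun _ _ => Finset.mem_coe.2 (Finset.mem_univ _)
        · intro T _ hT
          rw [Nat.cast_eq_zero, Finset.card_eq_zero, Finset.filter_eq_empty_iff]
          rintro g - ⟨hg, hs⟩
          obtain ⟨h1, h2, h3⟩ := hstep T g hg
          simp only [Fin.sum_univ_succ, Fin.cons_zero, Fin.cons_succ] at hs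
          obtain ⟨h4, h5⟩ := h2 (by omega)
          refine hT ⟨(topRow a T, topRow b (T.filter (a < ·))), ?_, h5.symm⟩
          simp only [Finset.coe_product, Set.mem_prod, Finset.mem_coe, Finset.mem_Iic,
            Finset.mem_Ioc]
          exact ⟨topRow_le _ _, h4, topRow_le _ _⟩
        · rintro ⟨x, y⟩ h
          simp only [Finset.mem_product, Finset.mem_Iic, Finset.mem_Ioc] at h
          obtain ⟨hx, hy, hyb⟩ := h
          have hy' : (a : ℕ) < y := hy
          have := (ih 0 (Nat.zero_le _) x y (hx.trans hy.le) (by omega)).2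
          rw [Nat.sub_zero] at this
          rw [← this]
          congr 2
          ext g
          have hc := card_Icc_union hx hy hyb
          simp only [Finset.mem_filter, Finset.mem_univ, true_and, isLayered_zero_cons,
            topRow_Icc_union hx hy, filter_Icc_union hy, topRow_Icc hyb, Fin.sum_univ_succ,
            Fin.cons_zero, Fin.cons_succ]
          have hTb : ∀ t ∈ Finset.Icc x a ∪ Finset.Icc y b, t ≤ b := fun t ht =>
            (Finset.mem_union.1 ht).elim (fun h => (Finset.mem_Icc.1 h).2.trans hab)
              fun h => (Finset.mem_Icc.1 h).2
          constructor
          · exact fun h => ⟨⟨hTb, h.1⟩, by omega⟩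
          · exact fun h => ⟨h.1.2, by omega⟩
    · have hstep : ∀ (T : Finset (Fin m)) (g : Fin q → Finset (Fin m)),
          IsLayered (k + 1) a b (Fin.cons T g : Fin (q + 1) → Finset (Fin m)) →
          T.card + topRow a T ≤ a + 1 ∧
          (T.card + topRow a T = a + 1 → T = Finset.Icc (topRow a T) a) ∧
          ∑ j, (g j).card + 1 + k ≤ topRow a T + b + 2 * q := by
        intro T g h
        rw [isLayered_succ_cons hab] at h
        have h1 := eq_Icc_of_le h.1
        exact ⟨h1.1, h1.2, (ih k (by omega) _ b ((topRow_le a T).trans hab) hb).1 g h.2⟩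
      constructor
      · intro f hf
        rw [← Fin.cons_self_tail f] at hf ⊢
        obtain ⟨h1, -, h2⟩ := hstep _ _ hf
        simp only [Fin.sum_univ_succ, Fin.cons_zero, Fin.cons_succ]
        omega
      · rw [card_filter_cons]
        push_cast
        rw [← Finset.sum_of_injOn (s := Finset.Iic a) (fun x : Fin m => Finset.Icc x a)
          (f := fun x => ((q.multichoose x * multichoosePred (q - k) b
            - multichoosePred q x * (q - k).multichoose b : ℤ)))]
        · rw [Finset.sum_sub_distrib, ← Finset.sum_mul, ← Finset.sum_mul,
            sum_Iic_val (fun x => (multichoosePred q x : ℤ)),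
            sum_Iic_val (fun x => (q.multichoose x : ℤ))]
          simp only [← Nat.cast_sum, sum_range_multichoose, sum_range_multichoosePred]
        · intro x h x' h' heq
          have e1 := congrArg (topRow a) heq
          simpa only [topRow_Icc (Finset.mem_Iic.1 (Finset.mem_coe.1 h)),
            topRow_Icc (Finset.mem_Iic.1 (Finset.mem_coe.1 h'))] using e1
        · exact fun _ _ => Finset.mem_coe.2 (Finset.mem_univ _)
        · intro T _ hT
          rw [Nat.cast_eq_zero, Finset.card_eq_zero, Finset.filter_eq_empty_iff]
          rintro g - ⟨hg, hs⟩
          obtain ⟨h1, h2, h3⟩ := hstep T g hg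
          simp only [Fin.sum_univ_succ, Fin.cons_zero, Fin.cons_succ] at hs
          exact hT ⟨topRow a T, Finset.mem_coe.2 (Finset.mem_Iic.2 (topRow_le _ _)),
            (h2 (by omega)).symm⟩
        · intro x hx
          rw [Finset.mem_Iic] at hx
          have hx' : (x : ℕ) ≤ a := hx
          rw [← (ih k (by omega) x b (hx.trans hab) hb).2]
          congr 2
          ext g
          have hc := Fin.card_Icc x a
          simp only [Finset.mem_filter, Finset.mem_univ, true_and, isLayered_succ_cons hab,
            topRow_Icc hx, Fin.sum_univ_succ, Fin.cons_zero, Fin.cons_succ]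
          constructor
          · exact fun h => ⟨⟨fun t ht => (Finset.mem_Icc.1 ht).2, h.1⟩, by omega⟩
          · exact fun h => ⟨h.1.2, by omega⟩

theorem multichoose_mul_multichoosePred_sub {N s M : ℕ} (hN : 0 < N) :
    (((N + 1).multichoose (M + 1) * multichoosePred (s + 1) (M + 1)
        - multichoosePred (N + 1) (M + 1) * (s + 1).multichoose (M + 1) : ℤ) : ℚ) =
      ((N : ℚ) - s) / N * (M + s).choose M * (M + N).choose (N - 1) := by
  have hX : ∀ t : ℕ, ((t + 1).multichoose (M + 1) : ℚ) =
      (t + M).choose M * (t + M + 1) / (M + 1) := by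
    intro t
    rw [Nat.multichoose_eq, eq_div_iff (by positivity)]
    have := Nat.add_one_mul_choose_eq (t + M) M
    rw [show t + 1 + (M + 1) - 1 = t + M + 1 by omega]
    rw [mul_comm] at this
    exact_mod_cast this.symm
  have hP : ∀ t : ℕ, multichoosePred (t + 1) (M + 1) = (t + M).choose M := by
    intro t
    rw [multichoosePred, Nat.multichoose_eq, show t + 1 + M - 1 = t + M by omega]
  have hC : ((M + N).choose (N - 1) : ℚ) = (N + M).choose M * N / (M + 1) := by
    rw [eq_div_iff (by positivity), ← Nat.choose_symm (by omega),
      show M + N - (N - 1) = M + 1 by omega]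
    have := Nat.choose_succ_right_eq (M + N) M
    rw [Nat.add_sub_cancel_left, add_comm M N] at this
    rw [add_comm M N]
    exact_mod_cast this
  push_cast
  rw [hX, hX, hP, hP, hC, add_comm M s]
  have : (N : ℚ) ≠ 0 := by positivity
  field_simp
  ring

/-- Sets of grid cells, viewed as tuples of columns. -/
def columnsEquiv (m n : ℕ) : Finset (Fin m × Fin n) ≃ (Fin n → Finset (Fin m)) where
  toFun F j := Finset.univ.filter fun i => (i, j) ∈ F
  invFun f := Finset.univ.filter fun z => z.1 ∈ f z.2
  left_inv F := by ext; simp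
  right_inv f := by ext; simp

theorem mem_columnsEquiv {m n : ℕ} {F : Finset (Fin m × Fin n)} {i : Fin m} {j : Fin n} :
    i ∈ columnsEquiv m n F j ↔ (i, j) ∈ F := by
  simp [columnsEquiv]

theorem sum_card_columnsEquiv {m n : ℕ} (F : Finset (Fin m × Fin n)) :
    ∑ j, (columnsEquiv m n F j).card = F.card := by
  rw [Finset.card_eq_sum_card_fiberwise (f := Prod.snd) (t := Finset.univ) (by simp)]
  refine Finset.sum_congr rfl fun j _ => Finset.card_bij (fun i _ => (i, j)) ?_ ?_ ?_
  · intro i hi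
    simpa using mem_columnsEquiv.1 hi
  · intro i _ i' _ h
    exact (Prod.mk.inj h).1
  · rintro ⟨i, j'⟩ h
    obtain ⟨hF, rfl⟩ := Finset.mem_filter.1 h
    exact ⟨i, mem_columnsEquiv.2 hF, rfl⟩

/-- The supports of the monomials counted by `P1`. -/
def IsP1Support {m n : ℕ} (ξ : ℕ) (F : Finset (Fin m × Fin n)) : Prop :=
  (∀ x ∈ F, ∀ y ∈ F, ∀ z ∈ F, x.1 < y.1 → x.2 < y.2 → y.2 < z.2 → z.1 ≤ y.1) ∧
  (∀ x ∈ F, ∀ y ∈ F, x.2 < y.2 → y.2.val + 1 < ξ → y.1 ≤ x.1)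

open Classical in
theorem P1_eq_card_filter (m n ξ r : ℕ) :
    P1 m n ξ r = (Finset.univ.filter fun f : Sym (Fin m × Fin n) r =>
      IsP1Support ξ (f : Multiset (Fin m × Fin n)).toFinset).card := by
  rw [P1, Nat.card_eq_fintype_card, Fintype.card_subtype]
  congr 1
  ext f
  have h3 : Has3Chain (idxMS m n r f) ↔ ∃ x ∈ f, ∃ y ∈ f, ∃ z ∈ f,
      x.1 < y.1 ∧ y.1 < z.1 ∧ x.2 < y.2 ∧ y.2 < z.2 := by
    simp [Has3Chain, idxMS]
  have h2 : Has2Chain ((idxMS m n r f).filter (fun p => p.2 < ξ)) ↔ ∃ x ∈ f, ∃ y ∈ f,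
      x.1 < y.1 ∧ x.2 < y.2 ∧ y.2.val + 1 < ξ := by
    simp only [Has2Chain, idxMS, Multiset.mem_filter, Multiset.mem_map, Sym.mem_coe]
    constructor
    · rintro ⟨_, ⟨⟨x, hx, rfl⟩, h⟩, _, ⟨⟨y, hy, rfl⟩, h'⟩, h1, h2⟩
      exact ⟨x, hx, y, hy, by simpa using h1, by simpa using h2, h'⟩
    · rintro ⟨x, hx, y, hy, h1, h2, h⟩
      exact ⟨_, ⟨⟨x, hx, rfl⟩, lt_trans (by simpa using h2) h⟩, _, ⟨⟨y, hy, rfl⟩, h⟩,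
        by simpa using h1, by simpa using h2⟩
  simp only [Finset.mem_filter, Finset.mem_univ, true_and, h3, h2, IsP1Support,
    Multiset.mem_toFinset, Sym.mem_coe]
  push Not
  exact ⟨fun h => ⟨fun x hx y hy z hz h1 h2 h3 => not_lt.1 fun h4 =>
      absurd (h.1 x hx y hy z hz h1 h4 h2) (not_le.2 h3),
      fun x hx y hy h1 h2 => not_lt.1 fun h3 => absurd (h.2 x hx y hy h3 h1) (not_le.2 h2)⟩,
    fun h => ⟨fun x hx y hy z hz h1 h2 h3 => not_lt.1 fun h4 =>
      absurd (h.1 x hx y hy z hz h1 h3 h4) (not_le.2 h2),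
      fun x hx y hy h1 h2 => not_lt.1 fun h3 => absurd (h.2 x hx y hy h2 h3) (not_le.2 h1)⟩⟩

theorem isLayered_columnsEquiv_iff {m n ξ : ℕ} (F : Finset (Fin (m + 1) × Fin n)) :
    IsLayered (max (ξ - 1) 1) (Fin.last m) (Fin.last m) (columnsEquiv (m + 1) n F) ↔
      IsP1Support ξ F := by
  simp only [IsLayered, mem_columnsEquiv, Fin.le_last, implies_true, true_and, IsP1Support,
    Prod.forall, (Fin.le_last _).not_gt, false_imp_iff]
  constructor
  · rintro ⟨h2, h3⟩
    refine ⟨fun i j hx i' j' hy i'' j'' hz h h' h'' => h3 j j' j'' h' h'' i hx i' hy i'' hz h, ?_⟩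
    exact fun i j hx i' j' hy h h' => h2 j j' h (by omega) i hx i' hy
  · rintro ⟨h3, h2⟩
    refine ⟨fun j j' h h' i hx i' hy => h2 i j hx i' j' hy h ?_,
      fun j j' j'' h' h'' i hx i' hy i'' hz h => h3 i j hx i' j' hy i'' j'' hz h h' h''⟩
    have : (j : ℕ) < j' := h
    omega

open Classical in
/-- If every monomial is counted, the normalized leading coefficient is `1`. -/
theorem P1_leadingCoeff_of_forall {m n ξ : ℕ} (hm : 1 ≤ m) (hn : 1 ≤ n)
    (hall : ∀ F : Finset (Fin m × Fin n), IsP1Support ξ F) (p : Polynomial ℚ)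
    (hp : ∀ᶠ r in Filter.atTop, (P1 m n ξ r : ℚ) = p.eval (r : ℚ)) :
    (Nat.factorial p.natDegree : ℚ) * p.leadingCoeff = 1 := by
  simp only [P1_eq_card_filter] at hp
  have hcard : Fintype.card (Fin m × Fin n) = m * n := by simp
  have h := factorial_mul_leadingCoeff_of_support (D := m * n) (N := 1) (IsP1Support ξ)
    (Nat.mul_pos hm hn) one_pos (fun F _ => hcard ▸ Finset.card_le_univ F) ?_ p hp
  · simpa using h
  · rw [Finset.card_eq_one]
    refine ⟨Finset.univ, ?_⟩
    ext F
    simp only [hall, true_and, Finset.mem_filter, Finset.mem_univ, Finset.mem_singleton,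
      ← hcard, Finset.card_eq_iff_eq_univ]

open Classical in
/-- The main case, where the columns without `2`-chains number effectively `max (ξ - 1) 1`. -/
theorem P1_leadingCoeff_of_two_le {M n ξ : ℕ} (hn : 3 ≤ n) (hξn : ξ ≤ n) (p : Polynomial ℚ)
    (hp : ∀ᶠ r in Filter.atTop, (P1 (M + 2) n ξ r : ℚ) = p.eval (r : ℚ)) :
    (Nat.factorial p.natDegree : ℚ) * p.leadingCoeff =
      (max (ξ - 1) 1 : ℕ) / ((n : ℚ) - 1) *
        (M + (n - 1 - max (ξ - 1) 1)).choose M * (M + (n - 1)).choose (n - 2) := by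
  simp only [P1_eq_card_filter] at hp
  set k := max (ξ - 1) 1 with hk
  have hkn : k ≤ n - 1 := by omega
  have hk1 : 1 ≤ k := le_max_right _ _
  obtain ⟨hle, hcard⟩ := card_isLayered n k (by omega) (Fin.last (M + 1)) (Fin.last (M + 1))
    le_rfl (by simp)
  simp only [Fin.val_last] at hle hcard
  have hval := multichoose_mul_multichoosePred_sub (N := n - 1) (s := n - 1 - k) (M := M)
    (by omega)
  rw [show n - 1 + 1 = n by omega, show n - 1 - k + 1 = n - k by omega, ← hcard,
    Nat.cast_sub hkn, sub_sub_cancel, Nat.cast_sub (by omega : 1 ≤ n), Nat.cast_one,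
    Int.cast_natCast, show n - 1 - 1 = n - 2 by omega] at hval
  rw [← hval]
  refine factorial_mul_leadingCoeff_of_support (D := 2 * M + 1 + 2 * n - k) (IsP1Support ξ)
    (by omega) ?_ ?_ ?_ p hp
  · rw [← Nat.cast_pos (α := ℚ), hval]
    have h1 : (0 : ℚ) < n - 1 := by
      rw [sub_pos]; exact_mod_cast (by omega : 1 < n)
    have h2 := Nat.choose_pos (Nat.le_add_right M (n - 1 - k))
    have h3 := Nat.choose_pos (by omega : n - 2 ≤ M + (n - 1))
    have h4 : 0 < k := hk1
    positivity
  · intro F hF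
    have := hle _ (isLayered_columnsEquiv_iff F |>.2 hF)
    rw [sum_card_columnsEquiv] at this
    omega
  · refine Finset.card_equiv (columnsEquiv _ n) fun F => ?_
    simp only [Finset.mem_filter, Finset.mem_univ, true_and, sum_card_columnsEquiv, hk,
      isLayered_columnsEquiv_iff]
    refine and_congr_right fun _ => ?_
    omega

/-- Proposition 2.3 (first part) of the paper: the leading coefficient of the eventual
polynomial of `P1`, normalized by the factorial of its degree. -/
theorem P1_leadingCoeff (m n ξ : ℕ) (hm : 1 ≤ m) (hn : 1 ≤ n) (hξ1 : 1 ≤ ξ) (hξn : ξ ≤ n)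
    (p : Polynomial ℚ)
    (hp : ∀ᶠ r in Filter.atTop, (P1 m n ξ r : ℚ) = p.eval (r : ℚ)) :
    (Nat.factorial p.natDegree : ℚ) * p.leadingCoeff =
      if m = 1 ∨ n < 3 then 1
      else if ξ = 1 then
        (1 / ((n : ℚ) - 1)) *
          (Nat.choose (m + n - 4) (m - 2) : ℚ) * (Nat.choose (m + n - 3) (n - 2) : ℚ)
      else
        (((ξ : ℚ) - 1) / ((n : ℚ) - 1)) *
          (Nat.choose (m + n - ξ - 2) (m - 2) : ℚ) * (Nat.choose (m + n - 3) (n - 2) : ℚ) := by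
  by_cases h : m = 1 ∨ n < 3
  · rw [if_pos h]
    refine P1_leadingCoeff_of_forall hm hn (fun F => ⟨?_, ?_⟩) p hp
    · rintro x - y - z - h1 h2 h3
      have h2 : (x.2 : ℕ) < y.2 := h2
      have h3 : (y.2 : ℕ) < z.2 := h3
      have h1 : (x.1 : ℕ) < y.1 := h1
      omega
    · rintro x - y - h1 h2
      have h1 : (x.2 : ℕ) < y.2 := h1
      rcases h with rfl | h
      · exact (Subsingleton.elim _ _).le
      · omega
  · rw [if_neg h]
    obtain ⟨M, rfl⟩ := Nat.exists_eq_add_of_le' (show 2 ≤ m by omega)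
    rw [P1_leadingCoeff_of_two_le (by omega) hξn p hp]
    split_ifs with hξ
    · subst hξ
      rw [show M + 2 + n - 4 = M + (n - 1 - max (1 - 1) 1) by simp; omega,
        show M + 2 + n - 3 = M + (n - 1) by omega]
      simp
    · rw [show max (ξ - 1) 1 = ξ - 1 by omega, Nat.cast_sub hξ1, Nat.cast_one,
        show M + 2 + n - ξ - 2 = M + (n - 1 - (ξ - 1)) by omega,
        show M + 2 + n - 3 = M + (n - 1) by omega]
      simp
end

section
/- (Proposition 4.1, independence of the leading coefficient; numerical form.) Let a, b : ℕ → ℕ be sequences, d ∈ ℕ, and let p, q ∈ ℚ[X] be polynomials such that for all sufficiently large k one has p(k) = a(k) − a(k−1), q(k) = b(k) − b(k−1), a(k) ≤ b(k+d), and b(k) ≤ a(k+d). Then p and q have the same degree and the same leading coefficient. -/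
open Polynomial Filter

/-- Every polynomial over `ℚ` is the forward difference of a polynomial. -/
theorem exists_taylor_one_sub_eq (p : ℚ[X]) : ∃ P : ℚ[X], taylor 1 P - P = p := by
  induction p using Polynomial.induction_on' with
  | add p q hp hq =>
    obtain ⟨P, rfl⟩ := hp
    obtain ⟨Q, rfl⟩ := hq
    exact ⟨P + Q, by rw [map_add]; ring⟩
  | monomial n c =>
    refine ⟨C (c / (n + 1)) * Polynomial.bernoulli (n + 1), ?_⟩
    have h : taylor 1 (Polynomial.bernoulli (n + 1)) =
        Polynomial.bernoulli (n + 1) + (n + 1) • X ^ n := by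
      rw [taylor_apply, C_1, add_comm X, Polynomial.bernoulli_comp_one_add_X, Nat.add_sub_cancel]
    have hn : (n + 1 : ℚ) ≠ 0 := by positivity
    rw [taylor_mul, taylor_C, h, mul_add, add_sub_cancel_left, nsmul_eq_mul,
      ← C_eq_natCast, ← mul_assoc, ← C_mul, ← C_mul_X_pow_eq_monomial]
    congr 2
    push_cast
    field_simp

/-- A sequence whose difference sequence is eventually polynomial is eventually polynomial. -/
theorem exists_eventually_eq_eval_of_sub_eq_eval (a : ℕ → ℕ) (p : ℚ[X])
    (hp : ∀ᶠ k : ℕ in atTop, p.eval (k : ℚ) = (a k : ℚ) - (a (k - 1) : ℚ)) :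
    ∃ A : ℚ[X], taylor 1 A - A = taylor 1 p ∧ ∀ᶠ k : ℕ in atTop, (a k : ℚ) = A.eval (k : ℚ) := by
  obtain ⟨P, hP⟩ := exists_taylor_one_sub_eq (taylor 1 p)
  obtain ⟨N, hN⟩ := eventually_atTop.1 hp
  refine ⟨P + C (a N - P.eval (N : ℚ)), ?_, ?_⟩
  · rw [map_add, taylor_C, add_sub_add_right_eq_sub, hP]
  · filter_upwards [eventually_ge_atTop N] with k hk
    induction k, hk using Nat.le_induction with
    | base => simp
    | succ k hk ih =>
      have h₁ := hN (k + 1) (by omega)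
      have h₂ := congrArg (eval (k : ℚ)) hP
      simp only [eval_sub, taylor_eval, eval_add, eval_C, Nat.add_sub_cancel] at h₁ h₂ ih ⊢
      push_cast at h₁ ⊢
      linarith

theorem degree_le_of_eventually_nonneg_le (R S : ℚ[X])
    (h : ∀ᶠ k : ℕ in atTop, 0 ≤ R.eval (k : ℚ) ∧ R.eval (k : ℚ) ≤ S.eval (k : ℚ)) :
    R.degree ≤ S.degree := by
  by_contra! hlt
  have hR : R ≠ 0 := ne_zero_of_degree_gt hlt
  have hcast := tendsto_natCast_atTop_atTop (R := ℚ)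
  have hsmall := ((S.div_tendsto_atTop_zero_of_degree_lt R hlt).comp hcast).eventually_lt_const
    one_pos
  have hroot := hcast.eventually (R.eventually_atTop_not_isRoot hR)
  obtain ⟨k, ⟨h₀, h₁⟩, h₂, h₃⟩ := (h.and (hsmall.and hroot)).exists
  have hpos := lt_of_le_of_ne h₀ (Ne.symm h₃)
  exact absurd ((div_lt_one hpos).1 h₂) h₁.not_gt

theorem degree_taylor_natCast_sub_le {R : Type*} [CommRing R] (B : R[X]) (n : ℕ) :
    (taylor (n : R) B - B).degree ≤ (taylor 1 B - B).degree := by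
  induction n with
  | zero => simp
  | succ n ih =>
    have h : taylor ((n + 1 : ℕ) : R) B - B =
        taylor (n : R) (taylor 1 B - B) + (taylor (n : R) B - B) := by
      rw [map_sub, taylor_taylor]
      push_cast
      ring
    rw [h]
    exact (degree_add_le _ _).trans (max_le (degree_taylor _ _).le ih)

theorem degree_taylor_sub_lt {R : Type*} [CommRing R] {p : R[X]} (r : R) (hp : p ≠ 0) :
    (taylor r p - p).degree < p.degree := by
  rw [← degree_taylor p r]
  exact degree_sub_lt_left (degree_taylor p r) (by rwa [Ne, taylor_eq_zero])
    (leadingCoeff_taylor ..)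


/-- Proposition 4.1 of the paper (numerical form): if two ℕ-valued sequences are
equivalent up to a shift `d` (`a k ≤ b (k+d)` and `b k ≤ a (k+d)` eventually), then the
polynomials eventually equal to their difference sequences have the same degree and the
same leading coefficient. -/
theorem leadingCoeff_independent (a b : ℕ → ℕ) (d : ℕ) (p q : Polynomial ℚ)
    (hp : ∀ᶠ (k : ℕ) in Filter.atTop,
      p.eval (k : ℚ) = (a k : ℚ) - (a (k - 1) : ℚ))
    (hq : ∀ᶠ (k : ℕ) in Filter.atTop,
      q.eval (k : ℚ) = (b k : ℚ) - (b (k - 1) : ℚ))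
    (hab : ∀ᶠ (k : ℕ) in Filter.atTop, a k ≤ b (k + d))
    (hba : ∀ᶠ (k : ℕ) in Filter.atTop, b k ≤ a (k + d)) :
    p.natDegree = q.natDegree ∧ p.leadingCoeff = q.leadingCoeff := by
  obtain ⟨A, hA, haA⟩ := exists_eventually_eq_eval_of_sub_eq_eval a p hp
  obtain ⟨B, hB, hbB⟩ := exists_eventually_eq_eval_of_sub_eq_eval b q hq
  have hshift (n : ℕ) : Tendsto (fun k : ℕ => k + n) atTop atTop := tendsto_add_atTop_nat n
  have hR : (taylor (d : ℚ) A - B).degree ≤ q.degree := by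
    rw [← degree_taylor q 1, ← hB]
    refine le_trans (degree_le_of_eventually_nonneg_le _ (taylor ((d + d : ℕ) : ℚ) B - B) ?_)
      (degree_taylor_natCast_sub_le B (d + d))
    filter_upwards [hbB, (hshift d).eventually haA, (hshift (d + d)).eventually hbB, hba,
      (hshift d).eventually hab] with k h₁ h₂ h₃ h₄ h₅
    rw [add_assoc] at h₅
    simp only [eval_sub, taylor_eval, ← Nat.cast_add, ← h₁, ← h₂, ← h₃, sub_nonneg,
      sub_le_sub_iff_right, Nat.cast_le]
    exact ⟨h₄, h₅⟩
  have hdiff : taylor 1 (taylor (d : ℚ) p - q) =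
      taylor 1 (taylor (d : ℚ) A - B) - (taylor (d : ℚ) A - B) := by
    have hA' := congrArg (taylor (d : ℚ)) hA
    simp only [map_sub, taylor_taylor, add_comm (d : ℚ) 1] at hA' ⊢
    rw [← hA', ← hB]
    ring
  rw [← natDegree_taylor p (d : ℚ), ← leadingCoeff_taylor (d : ℚ) p]
  by_cases h0 : taylor (d : ℚ) A - B = 0
  · rw [h0, map_zero, sub_zero, taylor_eq_zero, sub_eq_zero] at hdiff
    rw [hdiff]
    exact ⟨rfl, rfl⟩
  · have hlt : (taylor (d : ℚ) p - q).degree < q.degree := by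
      rw [← degree_taylor _ 1, hdiff]
      exact (degree_taylor_sub_lt 1 h0).trans_le hR
    rw [← sub_add_cancel (taylor (d : ℚ) p) q]
    exact ⟨natDegree_eq_of_degree_eq (degree_add_eq_right_of_degree_lt hlt),
      leadingCoeff_add_of_degree_lt hlt⟩
end

section
/- (Lemma 4.5, kernel of the substitution homomorphism on a bihomogeneous component.) Let F be a field of characteristic 0, let n ≥ 1 and 1 ≤ n_1 ≤ n be integers, and let R = F[x_1,…,x_n,y_1,…,y_n]. Let φ : R → R be the F-algebra endomorphism determined by φ(x_i) = y_i for 1 ≤ i ≤ n_1, φ(x_j) = x_j for n_1 < j ≤ n, and φ(y_j) = y_j for all j. For positive integers c_1, c_2, let R_{c_1,c_2} be the subspace spanned by the monomials of total degree c_1 in x_1,…,x_n and total degree c_2 in y_1,…,y_n. Then ker(φ) ∩ R_{c_1,c_2} = J ∩ R_{c_1,c_2}, where J is the ideal of R generated by the elements x_i y_j − x_j y_i with 1 ≤ i < j ≤ n_1. -/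
open MvPolynomial

/-- The `F`-algebra endomorphism `φ` of `R = F[x_1,…,x_n,y_1,…,y_n]` (with `Sum.inl i`
standing for `x_{i+1}` and `Sum.inr i` for `y_{i+1}`) that sends `x_i ↦ y_i` for
`1 ≤ i ≤ n₁` and fixes all other variables. -/
noncomputable def phiSub (F : Type*) [Field F] (n n₁ : ℕ) :
    MvPolynomial (Fin n ⊕ Fin n) F →ₐ[F] MvPolynomial (Fin n ⊕ Fin n) F :=
  aeval (fun v => match v with
    | Sum.inl i => if (i : ℕ) < n₁ then X (Sum.inr i) else X (Sum.inl i)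
    | Sum.inr j => X (Sum.inr j))

/-- The bihomogeneous component `R_{c₁,c₂}` of `R = F[x_1,…,x_n,y_1,…,y_n]`:
the span of the monomials of total degree `c₁` in the `x`-variables and total degree
`c₂` in the `y`-variables. -/
noncomputable def bihomComponent (F : Type*) [Field F] (n c₁ c₂ : ℕ) :
    Submodule F (MvPolynomial (Fin n ⊕ Fin n) F) :=
  Submodule.span F { q | ∃ d : (Fin n ⊕ Fin n) →₀ ℕ,
    (∑ i : Fin n, d (Sum.inl i)) = c₁ ∧ (∑ i : Fin n, d (Sum.inr i)) = c₂ ∧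
    q = monomial d (1 : F) }

/-- The ideal generated by the elements `x_i y_j - x_j y_i` for `i < j < n₁`. -/
noncomputable def minorIdeal (F : Type*) [Field F] (n n₁ : ℕ) :
    Ideal (MvPolynomial (Fin n ⊕ Fin n) F) :=
  Ideal.span { q : MvPolynomial (Fin n ⊕ Fin n) F | ∃ i j : Fin n, i < j ∧ (j : ℕ) < n₁ ∧
    q = X (Sum.inl i) * X (Sum.inr j) - X (Sum.inl j) * X (Sum.inr i) }

/-- The map on variables underlying `phiSub`. -/
def substVar (n n₁ : ℕ) : Fin n ⊕ Fin n → Fin n ⊕ Fin n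
  | Sum.inl i => if (i : ℕ) < n₁ then Sum.inr i else Sum.inl i
  | Sum.inr j => Sum.inr j

theorem phiSub_eq_rename (F : Type*) [Field F] (n n₁ : ℕ) :
    phiSub F n n₁ = rename (substVar n n₁) := by
  apply MvPolynomial.algHom_ext
  rintro (i | j)
  · by_cases h : (i : ℕ) < n₁ <;> simp [phiSub, substVar, h]
  · simp [phiSub, substVar]

theorem minor_mem_minorIdeal {F : Type*} [Field F] {n n₁ : ℕ} {i j : Fin n}
    (hi : (i : ℕ) < n₁) (hj : (j : ℕ) < n₁) :
    X (Sum.inl i) * X (Sum.inr j) - X (Sum.inl j) * X (Sum.inr i) ∈ minorIdeal F n n₁ := by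
  rcases lt_trichotomy i j with h | rfl | h
  · exact Ideal.subset_span ⟨i, j, h, hj, rfl⟩
  · simp
  · rw [← neg_sub]
    exact neg_mem (Ideal.subset_span ⟨j, i, h, hi, rfl⟩)

theorem minorIdeal_le_ker (F : Type*) [Field F] (n n₁ : ℕ) :
    minorIdeal F n n₁ ≤ RingHom.ker (phiSub F n n₁).toRingHom := by
  refine Ideal.span_le.2 ?_
  rintro _ ⟨i, j, hij, hj, rfl⟩
  have hi : (i : ℕ) < n₁ := lt_trans hij hj
  simp [RingHom.mem_ker, phiSub_eq_rename, substVar, hi, hj, mul_comm]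

theorem mapDomain_substVar_inl {n n₁ : ℕ} (d : (Fin n ⊕ Fin n) →₀ ℕ) (i : Fin n) :
    d.mapDomain (substVar n n₁) (Sum.inl i) = if (i : ℕ) < n₁ then 0 else d (Sum.inl i) := by
  have key (x : Fin n) : (Finsupp.single (substVar n n₁ (Sum.inl x)) (d (Sum.inl x)))
      (Sum.inl i) = if x = i then (if (i : ℕ) < n₁ then 0 else d (Sum.inl i)) else 0 := by
    by_cases hx : x = i
    · subst hx
      by_cases h : (x : ℕ) < n₁ <;> simp [substVar, h]
    · by_cases h : (x : ℕ) < n₁ <;> simp [substVar, h, hx]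
  rw [Finsupp.mapDomain, Finsupp.sum_fintype _ _ (by simp), Finsupp.finsetSum_apply,
    Fintype.sum_sum_type]
  simp [key]
  simp [substVar]

theorem mapDomain_substVar_inr {n n₁ : ℕ} (d : (Fin n ⊕ Fin n) →₀ ℕ) (i : Fin n) :
    d.mapDomain (substVar n n₁) (Sum.inr i) =
      (if (i : ℕ) < n₁ then d (Sum.inl i) else 0) + d (Sum.inr i) := by
  have key (x : Fin n) : (Finsupp.single (substVar n n₁ (Sum.inl x)) (d (Sum.inl x)))
      (Sum.inr i) = if x = i then (if (i : ℕ) < n₁ then d (Sum.inl i) else 0) else 0 := by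
    by_cases hx : x = i
    · subst hx
      by_cases h : (x : ℕ) < n₁ <;> simp [substVar, h]
    · by_cases h : (x : ℕ) < n₁ <;> simp [substVar, h, hx]
  rw [Finsupp.mapDomain, Finsupp.sum_fintype _ _ (by simp), Finsupp.finsetSum_apply,
    Fintype.sum_sum_type]
  simp [key]
  simp [substVar, Finsupp.single_apply]

/-- Replacing a factor `x_i y_j` of a monomial by `x_j y_i` does not change its class. -/
theorem monomial_sub_swap_mem {F : Type*} [Field F] {n n₁ : ℕ} {i j : Fin n}
    (hi : (i : ℕ) < n₁) (hj : (j : ℕ) < n₁) (e : (Fin n ⊕ Fin n) →₀ ℕ) :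
    monomial (e + Finsupp.single (Sum.inl i) 1 + Finsupp.single (Sum.inr j) 1) (1 : F) -
      monomial (e + Finsupp.single (Sum.inl j) 1 + Finsupp.single (Sum.inr i) 1) 1 ∈
      minorIdeal F n n₁ := by
  have h := (minorIdeal F n n₁).mul_mem_left (monomial e 1) (minor_mem_minorIdeal hi hj)
  convert h using 1
  simp [X, mul_sub, monomial_mul, add_assoc]

/-- Monomials of equal `x`-degree with the same image under `phiSub` are congruent modulo the
ideal of minors. -/
theorem monomial_sub_monomial_mem {F : Type*} [Field F] {n n₁ : ℕ}
    (d d' : (Fin n ⊕ Fin n) →₀ ℕ)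
    (hdeg : ∑ i : Fin n, d (Sum.inl i) = ∑ i : Fin n, d' (Sum.inl i))
    (hmap : d.mapDomain (substVar n n₁) = d'.mapDomain (substVar n n₁)) :
    monomial d (1 : F) - monomial d' 1 ∈ minorIdeal F n n₁ := by
  induction hN : ∑ i : Fin n, (d (Sum.inl i) - d' (Sum.inl i)) using Nat.strong_induction_on
    generalizing d with
  | _ N ih =>
  have hl (i : Fin n) := DFunLike.congr_fun hmap (Sum.inl i)
  have hr (i : Fin n) := DFunLike.congr_fun hmap (Sum.inr i)
  simp only [mapDomain_substVar_inl] at hl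
  simp only [mapDomain_substVar_inr] at hr
  by_cases hle : ∀ i, d (Sum.inl i) ≤ d' (Sum.inl i)
  · have heq := (Finset.sum_eq_sum_iff_of_le fun i _ => hle i).1 hdeg
    have hdd : d = d' := by
      ext (i | i)
      · exact heq i (Finset.mem_univ i)
      · have h₁ := heq i (Finset.mem_univ i)
        have h₂ := hr i
        rw [h₁] at h₂
        exact Nat.add_left_cancel h₂
    simp [hdd]
  · push Not at hle
    obtain ⟨i, hi⟩ := hle
    obtain ⟨j, hj⟩ : ∃ j, d (Sum.inl j) < d' (Sum.inl j) := by
      by_contra! hge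
      exact (Finset.sum_lt_sum (fun k _ => hge k) ⟨i, Finset.mem_univ i, hi⟩).ne' hdeg
    have hin : (i : ℕ) < n₁ := by
      by_contra h
      have := hl i
      simp only [h, if_false] at this
      omega
    have hjn : (j : ℕ) < n₁ := by
      by_contra h
      have := hl j
      simp only [h, if_false] at this
      omega
    have hij : i ≠ j := by rintro rfl; omega
    have hjr : 0 < d (Sum.inr j) := by
      have := hr j
      simp only [hjn, if_true] at this
      omega
    obtain ⟨e, rfl⟩ : ∃ e, d = e + Finsupp.single (Sum.inl i) 1 + Finsupp.single (Sum.inr j) 1 := by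
      refine ⟨d - (Finsupp.single (Sum.inl i) 1 + Finsupp.single (Sum.inr j) 1), ?_⟩
      rw [add_assoc, tsub_add_cancel_of_le]
      rintro (k | k)
      · by_cases hk : i = k
        · subst hk
          simpa using (by omega : 1 ≤ d (Sum.inl i))
        · simp [hk]
      · by_cases hk : j = k
        · subst hk
          simpa using (by omega : 1 ≤ d (Sum.inr j))
        · simp [hk]
    rw [← sub_add_sub_cancel]
    refine add_mem (monomial_sub_swap_mem hin hjn e) (ih _ ?_ _ ?_ ?_ rfl)
    · rw [← hN]
      refine Finset.sum_lt_sum (fun k _ => ?_) ⟨i, Finset.mem_univ i, ?_⟩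
      · by_cases hk : j = k
        · subst hk
          simp [hij] at hj ⊢
          omega
        · simp [hk]
          omega
      · simp [hij.symm] at hi ⊢
        omega
    · rw [← hdeg]
      simp [Finset.sum_add_distrib, Finsupp.single_apply]
    · rw [← hmap]
      simp only [Finsupp.mapDomain_add, Finsupp.mapDomain_single, substVar, hin, hjn, if_true]
      abel

/-- Lemma 4.5 of the paper: on each bihomogeneous component `R_{c₁,c₂}` with
`c₁, c₂ > 0`, the kernel of the substitution homomorphism `φ` coincides with the ideal
generated by the elements `x_i y_j - x_j y_i`, `1 ≤ i < j ≤ n₁`. -/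
theorem ker_phiSub_eq {F : Type*} [Field F] [CharZero F] (n n₁ c₁ c₂ : ℕ)
    (hn : 1 ≤ n) (h1 : 1 ≤ n₁) (h2 : n₁ ≤ n) (hc₁ : 0 < c₁) (hc₂ : 0 < c₂) :
    Submodule.restrictScalars F (RingHom.ker (phiSub F n n₁).toRingHom) ⊓
        bihomComponent F n c₁ c₂ =
      Submodule.restrictScalars F (Ideal.span
          { q : MvPolynomial (Fin n ⊕ Fin n) F | ∃ i j : Fin n, i < j ∧ (j : ℕ) < n₁ ∧
            q = X (Sum.inl i) * X (Sum.inr j) - X (Sum.inl j) * X (Sum.inr i) }) ⊓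
        bihomComponent F n c₁ c₂ := by
  change _ = Submodule.restrictScalars F (minorIdeal F n n₁) ⊓ _
  refine le_antisymm (le_inf ?_ inf_le_right)
    (inf_le_inf_right _ fun f hf => minorIdeal_le_ker F n n₁ hf)
  rintro f ⟨hker, hf⟩
  classical
  let P (e d : (Fin n ⊕ Fin n) →₀ ℕ) : Prop :=
    ∑ i : Fin n, d (Sum.inl i) = c₁ ∧ d.mapDomain (substVar n n₁) = e
  -- A linear section of `phiSub` modulo the ideal, on monomials of `x`-degree `c₁`.
  let L : MvPolynomial (Fin n ⊕ Fin n) F →ₗ[F] MvPolynomial (Fin n ⊕ Fin n) F :=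
    (basisMonomials (Fin n ⊕ Fin n) F).constr F
      fun e => monomial (Classical.epsilon (P e)) 1
  have hL (e : (Fin n ⊕ Fin n) →₀ ℕ) :
      L (monomial e 1) = monomial (Classical.epsilon (P e)) 1 := by
    rw [← congrFun (coe_basisMonomials (Fin n ⊕ Fin n) F) e]
    exact Module.Basis.constr_basis _ _ _ _
  have key : bihomComponent F n c₁ c₂ ≤ (Submodule.restrictScalars F (minorIdeal F n n₁)).comap
      (LinearMap.id - L ∘ₗ (phiSub F n n₁).toLinearMap) := by
    refine Submodule.span_le.2 ?_
    rintro _ ⟨d, hd, -, rfl⟩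
    have hP : P (d.mapDomain (substVar n n₁)) (Classical.epsilon _) :=
      Classical.epsilon_spec ⟨d, hd, rfl⟩
    have := monomial_sub_monomial_mem (F := F) d _ (hd.trans hP.1.symm) hP.2.symm
    simpa [phiSub_eq_rename, rename_monomial, hL] using this
  have hφ : phiSub F n n₁ f = 0 := hker
  simpa [hφ] using key hf
end
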